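/- For every ε > 0 there exists a finite constant C_ε such that for every segment Λ ⊂ ℤ with |Λ| = L ≥ 2, every N ≥ 1 and every f ≥ 0, ν_Λ^N[ f , Σ_{x∈Λ} c(η_x) ]² ≤ N ν_Λ^N[f] ( C_ε ν_Λ^N[f] + C_ε L² E_{ν_Λ^N}(√f,√f) + ε Ent_{ν_Λ^N}(f) ). -/

import Mathlib

open scoped BigOperators

noncomputable section

/-- `cfact c k = c(k)! = c(1)⋯c(k)`, with `cfact c 0 = 1`. -/
def cfact (c : ℕ → ℝ) : ℕ → ℝ
  | 0 => 1
  | k + 1 => cfact c k * c (k + 1)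

/-- The configuration obtained from `η` by moving one particle from `x` to `y` (`x ≠ y`),
i.e. `η - δ^x + δ^y`. -/
def move (η : ℤ → ℕ) (x y : ℤ) : ℤ → ℕ :=
  fun z => if z = x then η x - 1 else if z = y then η y + 1 else η z

/-- Unnormalized weight of the canonical measure `ν_Λ^N` on configurations supported in `Λ`
with `N` particles: `∏_{x∈Λ} 1/c(η_x)!`. -/
def nuW (c : ℕ → ℝ) (Λ : Finset ℤ) (N : ℕ) : (ℤ → ℕ) → ℝ :=
  Set.indicator {η : ℤ → ℕ | (∀ x, x ∉ Λ → η x = 0) ∧ (∑ x ∈ Λ, η x) = N}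
    (fun η => ∏ x ∈ Λ, (cfact c (η x))⁻¹)

/-- Expectation with respect to the probability measure obtained by normalizing the
nonnegative weight `w`. -/
def wE (w f : (ℤ → ℕ) → ℝ) : ℝ :=
  (∑' η : ℤ → ℕ, w η * f η) / (∑' η : ℤ → ℕ, w η)

/-- Covariance `μ[f,g] = μ[f g] - μ[f] μ[g]`. -/
def wCov (w f g : (ℤ → ℕ) → ℝ) : ℝ :=
  wE w (fun η => f η * g η) - wE w f * wE w g

/-- Entropy `Ent_μ(f) = μ[f log f] - μ[f] log μ[f]` (note `Real.log 0 = 0`, giving the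
convention `0 log 0 = 0`). -/
def wEnt (w f : (ℤ → ℕ) → ℝ) : ℝ :=
  wE w (fun η => f η * Real.log (f η)) - wE w f * Real.log (wE w f)

/-- Dirichlet form of the zero-range process on `Λ`:
`E(f,g) = (1/2) Σ_{x∈Λ} Σ_{y∈Λ, |x-y|=1} μ[c(η_x) ∂_{xy}f ∂_{xy}g]`. -/
def wDir (c : ℕ → ℝ) (Λ : Finset ℤ) (w f g : (ℤ → ℕ) → ℝ) : ℝ :=
  wE w (fun η => (1 / 2) * ∑ x ∈ Λ, ∑ y ∈ Λ,
    if |x - y| = 1 then c (η x) * ((f (move η x y) - f η) * (g (move η x y) - g η)) else 0)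

/-- Weight conditioned on the event `∑_{x ∈ Λ₁} η x = n`. -/
def condW (w : (ℤ → ℕ) → ℝ) (Λ₁ : Finset ℤ) (n : ℕ) : (ℤ → ℕ) → ℝ :=
  Set.indicator {η : ℤ → ℕ | (∑ x ∈ Λ₁, η x) = n} w

/-- `h(n) = (n+1)/c(n+1)`. -/
def hfun (c : ℕ → ℝ) (n : ℕ) : ℝ := (n + 1) / c (n + 1)


/-- Solution of the one-site equation. -/
structure SiteSol (c : ℕ → ℝ) (N : ℕ) (ρ lam : ℝ) (a : ℕ → ℝ) : Prop where
  lam_pos : 0 < lam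
  lam_lt : lam < c N
  zero : lam * a 0 = ρ
  step : ∀ k, lam * a (k+1) = c (k+1) * a k - ((k:ℝ)+1-ρ)
  top : (c N - lam) * a N = N - ρ
  topeq : a (N-1) = a N
  pos : ∀ k ≤ N, 0 < a k

lemma c_lip (c : ℕ → ℝ) (a₁ : ℝ) (hLG : ∀ k : ℕ, |c (k + 1) - c k| ≤ a₁) (j i : ℕ) :
    |c (j+i) - c j| ≤ a₁ * i := by
  induction i with
  | zero => simp
  | succ n ih =>
    have h := hLG (j+n)
    have e : c (j+(n+1)) - c j = (c (j+n+1) - c (j+n)) + (c (j+n) - c j) := by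
      rw [show j+(n+1) = j+n+1 by ring]; ring
    rw [e]; push_cast
    linarith [abs_add_le (c (j+n+1) - c (j+n)) (c (j+n) - c j)]

lemma c_lower (c : ℕ → ℝ) (a₁ a₂ : ℝ) (k₀ : ℕ) (hLG : ∀ k : ℕ, |c (k + 1) - c k| ≤ a₁)
    (hk₀ : 0 < k₀) (ha₂ : 0 < a₂)
    (hM : ∀ j k : ℕ, j + k₀ ≤ k → a₂ ≤ c k - c j) (j i : ℕ) :
    a₂ / k₀ * i - (a₂ + a₁ * k₀) ≤ c (j+i) - c j := by
  have ha₁ : 0 ≤ a₁ := (abs_nonneg _).trans (hLG 0)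
  have hk : (0:ℝ) < k₀ := by exact_mod_cast hk₀
  have key : ∀ q : ℕ, a₂ * q ≤ c (j + q * k₀) - c j := by
    intro q
    induction q with
    | zero => simp
    | succ n ih =>
      have := hM (j + n*k₀) (j + (n+1)*k₀) (by ring_nf; omega)
      push_cast; linarith
  obtain ⟨q, r, hr, rfl⟩ : ∃ q r : ℕ, r < k₀ ∧ i = q * k₀ + r :=
    ⟨i / k₀, i % k₀, Nat.mod_lt _ hk₀, by rw [mul_comm]; exact (Nat.div_add_mod i k₀).symm⟩
  have h1 := key q
  have h2 := (abs_le.1 (c_lip c a₁ hLG (j+q*k₀) r)).1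
  have hr' : (r:ℝ) ≤ k₀ := by exact_mod_cast hr.le
  have h3 : a₁ * r ≤ a₁ * k₀ := mul_le_mul_of_nonneg_left hr' ha₁
  have h4 : a₂ / k₀ * ((q * k₀ + r : ℕ):ℝ) ≤ a₂ * q + a₂ := by
    push_cast
    have : a₂ / k₀ * (q * k₀ + r) = a₂ * q + a₂ * (r / k₀) := by field_simp
    rw [this]
    have : (r:ℝ)/k₀ ≤ 1 := (div_le_one hk).2 hr'
    nlinarith
  rw [show j + (q*k₀+r) = j + q*k₀ + r by ring]
  linarith

lemma c_min (c : ℕ → ℝ) (a₂ : ℝ) (k₀ : ℕ) (hc0 : c 0 = 0) (hcpos : ∀ n : ℕ, 0 < n → 0 < c n)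
    (ha₂ : 0 < a₂) (hM : ∀ j k : ℕ, j + k₀ ≤ k → a₂ ≤ c k - c j) :
    ∃ κ : ℝ, 0 < κ ∧ ∀ k, 1 ≤ k → κ ≤ c k := by
  have h : ∀ n : ℕ, ∃ κ : ℝ, 0 < κ ∧ ∀ k, 1 ≤ k → k ≤ n → κ ≤ c k := by
    intro n
    induction n with
    | zero => exact ⟨1, one_pos, fun k h1 h2 => by omega⟩
    | succ n ih =>
      obtain ⟨κ, h0, h⟩ := ih
      refine ⟨min κ (c (n+1)), lt_min h0 (hcpos _ (by omega)), fun k h1 h2 => ?_⟩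
      rcases Nat.lt_or_ge n k with h3 | h3
      · have : k = n+1 := by omega
        subst this; exact min_le_right _ _
      · exact (min_le_left _ _).trans (h k h1 h3)
  obtain ⟨κ, h0, h⟩ := h k₀
  refine ⟨min κ a₂, lt_min h0 ha₂, fun k h1 => ?_⟩
  rcases le_total k k₀ with h3 | h3
  · exact (min_le_left _ _).trans (h k h1 h3)
  · have := hM 0 k (by omega)
    rw [hc0, sub_zero] at this
    exact (min_le_right _ _).trans this

/-- polynomial version of the solution. -/
noncomputable def pseq (c : ℕ → ℝ) (ρ lam : ℝ) : ℕ → ℝ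
  | 0 => ρ
  | k+1 => c (k+1) * pseq c ρ lam k - ((k:ℝ)+1-ρ) * lam^(k+1)

lemma pseq_cont (c : ℕ → ℝ) (ρ : ℝ) (k : ℕ) : Continuous (fun lam => pseq c ρ lam k) := by
  induction k with
  | zero => simp only [pseq]; fun_prop
  | succ n ih => simp only [pseq]; fun_prop

lemma pseq_zero (c : ℕ → ℝ) (hcpos : ∀ n : ℕ, 0 < n → 0 < c n) (ρ : ℝ) (hρ : 0 < ρ) (k : ℕ) :
    0 < pseq c ρ 0 k := by
  induction k with
  | zero => simpa [pseq]
  | succ n ih => simp only [pseq]; simp; exact mul_pos (hcpos _ (by omega)) ih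

lemma exists_sol (c : ℕ → ℝ) (hcpos : ∀ n : ℕ, 0 < n → 0 < c n) (N : ℕ) (ρ : ℝ)
    (hN : 1 ≤ N) (hρ : 0 < ρ) (hρN : ρ < N) : ∃ lam a, SiteSol c N ρ lam a := by
  have hcN := hcpos N hN
  let Ψ : ℝ → ℝ := fun lam => (c N - lam) * pseq c ρ lam (N-1) - (N-ρ) * lam^N
  have hcont : Continuous Ψ := by
    have := pseq_cont c ρ (N-1)
    fun_prop
  have h0 : 0 < Ψ 0 := by
    simp only [Ψ, sub_zero]
    rw [zero_pow (by omega)]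
    have := mul_pos hcN (pseq_zero c hcpos ρ hρ (N-1))
    linarith
  have h1 : Ψ (c N) < 0 := by
    simp only [Ψ, sub_self]
    have := mul_pos (sub_pos.2 hρN) (pow_pos hcN N)
    linarith
  obtain ⟨lam, ⟨hl0, hl1⟩, hl⟩ := intermediate_value_Icc' hcN.le hcont.continuousOn ⟨h1.le, h0.le⟩
  have hl0' : 0 < lam := lt_of_le_of_ne hl0 (by rintro rfl; linarith)
  have hl1' : lam < c N := lt_of_le_of_ne hl1 (by rintro rfl; linarith)
  let a : ℕ → ℝ := fun k => pseq c ρ lam k / lam^(k+1)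
  have hstep : ∀ k, lam * a (k+1) = c (k+1) * a k - ((k:ℝ)+1-ρ) := by
    intro k; simp only [a, pseq]; field_simp; ring
  have hzero : lam * a 0 = ρ := by simp only [a, pseq]; field_simp; ring
  have htop' : (c N - lam) * a (N-1) = N - ρ := by
    simp only [a]
    have : (c N - lam) * pseq c ρ lam (N-1) = (N-ρ) * lam^N := by
      simp only [Ψ] at hl; linarith
    rw [Nat.sub_add_cancel hN, ← mul_div_assoc, this]; field_simp
  have htopeq : a (N-1) = a N := by
    have := hstep (N-1)
    rw [Nat.sub_add_cancel hN] at this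
    have hc : ((N-1:ℕ):ℝ) + 1 = N := by exact_mod_cast Nat.sub_add_cancel hN
    rw [hc] at this
    have : lam * (a (N-1) - a N) = 0 := by linarith
    rcases mul_eq_zero.1 this with h | h
    · linarith
    · linarith
  have htop : (c N - lam) * a N = N - ρ := by rw [← htopeq]; exact htop'
  have hN0 : 0 < a N := by
    by_contra h
    push Not at h
    have := mul_nonpos_of_nonneg_of_nonpos (sub_nonneg.2 hl1) h
    linarith
  have hup : ∀ k : ℕ, (k:ℝ) ≤ ρ → 0 < a k := by
    intro k
    induction k with
    | zero => intro _; exact pos_of_mul_pos_right (by rw [hzero]; exact hρ) hl0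
    | succ n ih =>
      intro h
      push_cast at h
      have h1 := ih (by linarith)
      have h2 := hstep n
      have h3 := mul_pos (hcpos (n+1) (by omega)) h1
      exact pos_of_mul_pos_right (a := lam) (by linarith) hl0
  have hdown : ∀ i k : ℕ, k + i = N → ρ ≤ k → 0 < a k := by
    intro i
    induction i with
    | zero => intro k hk _; simp at hk; subst hk; exact hN0
    | succ n ih =>
      intro k hk h
      have h1 := ih (k+1) (by omega) (by push_cast; linarith)
      have h2 := hstep k
      have h3 := mul_pos hl0' h1
      exact pos_of_mul_pos_right (a := c (k+1)) (by linarith) (hcpos _ (by omega)).le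
  refine ⟨lam, a, hl0', hl1', hzero, hstep, htop, htopeq, fun k hk => ?_⟩
  rcases le_total (k:ℝ) ρ with h | h
  · exact hup k h
  · exact hdown (N-k) k (by omega) h

/-- upper bound on lam -/
lemma lam_le (c : ℕ → ℝ) (a₁ : ℝ) (hc0 : c 0 = 0) (hcpos : ∀ n : ℕ, 0 < n → 0 < c n)
    (hLG : ∀ k : ℕ, |c (k + 1) - c k| ≤ a₁) (N : ℕ) (ρ lam : ℝ) (a : ℕ → ℝ)
    (hN : 1 ≤ N) (hρ : 0 < ρ) (hρN : 2 * ρ ≤ N) (h : SiteSol c N ρ lam a) :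
    lam ≤ 4 * a₁ * ρ := by
  have hc : ∀ k, c k ≤ a₁ * k := by
    intro k
    have := (abs_le.1 (c_lip c a₁ hLG 0 k)).2
    rw [zero_add, hc0, sub_zero] at this; exact this
  have ha₁ : 0 < a₁ := by have := hc 1; have := hcpos 1 one_pos; norm_num at *; linarith
  rcases le_total ρ (1/2) with h1 | h1
  · have h2 := h.pos 1 hN
    have h3 := h.step 0
    have h4 := h.zero
    have h5 := mul_pos h.lam_pos h2
    have h6 := hc 1
    have h7 := h.pos 0 (by omega)
    have h8 := h.lam_pos
    norm_num at *
    have : c 1 * a 0 > 1/2 := by linarith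
    have : a₁ * a 0 > 1/2 := by nlinarith
    have : lam * (a₁ * a 0) = a₁ * ρ := by rw [← h4]; ring
    nlinarith
  · by_contra hcon
    push Not at hcon
    set K := ⌈2*ρ⌉₊ with hK
    have hK1 : 2*ρ ≤ K := Nat.le_ceil _
    have hK2 : (K:ℝ) < 2*ρ+1 := Nat.ceil_lt_add_one (by linarith)
    have hKN : K ≤ N := Nat.ceil_le.2 hρN
    have key : ∀ k, k ≤ K → lam * a k ≤ ρ - (k*(k+1)/2 - k*ρ) := by
      intro k
      induction k with
      | zero => intro _; simp [h.zero]
      | succ n ih =>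
        intro hn
        have h2 := ih (by omega)
        have h3 := h.step n
        have h4 := h.pos n (by omega)
        have h5 := hc (n+1)
        have h6 : ((n+1:ℕ):ℝ) ≤ K := by exact_mod_cast hn
        push_cast at *
        have h7 : c (n+1) ≤ lam := by nlinarith
        have h8 := mul_le_mul_of_nonneg_right h7 h4.le
        linarith
    have h2 := key K le_rfl
    have h3 := mul_pos h.lam_pos (h.pos K hKN)
    nlinarith


/-- Collected facts on the rate function. -/
structure CH (c : ℕ → ℝ) (a₁ θ B κ : ℝ) : Prop where
  a1_pos : 0 < a₁
  th_pos : 0 < θ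
  B_nonneg : 0 ≤ B
  kap_pos : 0 < κ
  c0 : c 0 = 0
  lip : ∀ j i : ℕ, |c (j+i) - c j| ≤ a₁ * i
  lower : ∀ j i : ℕ, θ * i - B ≤ c (j+i) - c j
  cmin : ∀ k, 1 ≤ k → κ ≤ c k
  cle : ∀ k : ℕ, c k ≤ a₁ * k
  lamle : ∀ (N : ℕ) (ρ lam : ℝ) (a : ℕ → ℝ), 1 ≤ N → 0 < ρ → 2 * ρ ≤ N → SiteSol c N ρ lam a →
    lam ≤ 4 * a₁ * ρ

lemma exists_CH (c : ℕ → ℝ) (a₁ a₂ : ℝ) (k₀ : ℕ)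
    (hc0 : c 0 = 0) (hcpos : ∀ n : ℕ, 0 < n → 0 < c n)
    (hLG : ∀ k : ℕ, |c (k + 1) - c k| ≤ a₁)
    (hk₀ : 0 < k₀) (ha₂ : 0 < a₂)
    (hM : ∀ j k : ℕ, j + k₀ ≤ k → a₂ ≤ c k - c j) : ∃ θ B κ, CH c a₁ θ B κ := by
  obtain ⟨κ, hκ, hκ'⟩ := c_min c a₂ k₀ hc0 hcpos ha₂ hM
  have hk : (0:ℝ) < k₀ := by exact_mod_cast hk₀
  have hc : ∀ k : ℕ, c k ≤ a₁ * k := by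
    intro k
    have := (abs_le.1 (c_lip c a₁ hLG 0 k)).2
    rw [zero_add, hc0, sub_zero] at this; exact this
  have ha₁ : 0 < a₁ := by have := hc 1; have := hcpos 1 one_pos; norm_num at *; linarith
  exact ⟨a₂/k₀, a₂ + a₁*k₀, κ, ha₁, by positivity, by positivity, hκ, hc0, c_lip c a₁ hLG,
    c_lower c a₁ a₂ k₀ hLG hk₀ ha₂ hM, hκ', hc,
    fun N ρ lam a h1 h2 h3 h => lam_le c a₁ hc0 hcpos hLG N ρ lam a h1 h2 h3 h⟩

lemma CH.cpos {c : ℕ → ℝ} {a₁ θ B κ : ℝ} (H : CH c a₁ θ B κ) (k : ℕ) : 0 < c (k+1) :=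
  H.kap_pos.trans_le (H.cmin _ (by omega))

lemma CH.cnonneg {c : ℕ → ℝ} {a₁ θ B κ : ℝ} (H : CH c a₁ θ B κ) (k : ℕ) : 0 ≤ c k := by
  cases k with
  | zero => rw [H.c0]
  | succ n => exact (H.cpos n).le

set_option maxHeartbeats 1000000 in
lemma small_case {c : ℕ → ℝ} {a₁ θ B κ : ℝ} (H : CH c a₁ θ B κ) (ρ₀ : ℝ) (hρ₀ : 0 < ρ₀) :
    ∃ m S : ℝ, ∃ K : ℕ, 0 < m ∧ 0 < S ∧ ∀ (N : ℕ) (ρ lam : ℝ) (a : ℕ → ℝ), K ≤ N → 1 ≤ N →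
      0 < ρ → ρ ≤ ρ₀ → 2 * ρ ≤ N → SiteSol c N ρ lam a → ∀ k ≤ N, m ≤ a k ∧ a k ≤ S := by
  have ha₁ := H.a1_pos
  have hθ := H.th_pos
  have hB := H.B_nonneg
  have hκ := H.kap_pos
  set Λ := 4 * a₁ * ρ₀ with hΛ
  have hΛ0 : 0 < Λ := by positivity
  obtain ⟨K, hK⟩ := exists_nat_ge (2*(B+Λ)/θ)
  have hK' : B + Λ ≤ θ/2*K := by
    rw [div_le_iff₀ hθ] at hK; linarith
  set q := max 1 ((Λ+K)/κ) with hq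
  have hq1 : 1 ≤ q := le_max_left _ _
  have hq2 : (Λ+K) ≤ q * κ := by
    have : (Λ+K)/κ ≤ q := le_max_right _ _
    rwa [div_le_iff₀ hκ] at this
  set S := max 1 (2/θ) with hS
  have hS1 : 1 ≤ S := le_max_left _ _
  have hS2 : 2/θ ≤ S := le_max_right _ _
  have hS2' : 1 ≤ S * (θ/2) := by
    have := mul_le_mul_of_nonneg_right hS2 (half_pos hθ).le
    have e : 2/θ*(θ/2) = 1 := by field_simp
    linarith
  set r := min 1 (κ/Λ) with hr
  have hr0 : 0 < r := lt_min one_pos (by positivity)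
  have hr1 : r ≤ 1 := min_le_left _ _
  have hr2 : r * Λ ≤ κ := by
    have : r ≤ κ/Λ := min_le_right _ _
    rwa [le_div_iff₀ hΛ0] at this
  set m₁ := 1/(2*a₁*(1+ρ₀)) with hm₁
  have hm₁0 : 0 < m₁ := by positivity
  set m₂ := 1/(4*a₁) * r^(⌈ρ₀⌉₊) with hm₂
  have hm₂0 : 0 < m₂ := by positivity
  refine ⟨min m₁ m₂, S * q^K, K, lt_min hm₁0 hm₂0, by positivity, ?_⟩
  intro N ρ lam a hKN hN hρ hρρ hρN h
  have hl := H.lamle N ρ lam a hN hρ hρN h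
  have hl' : lam ≤ Λ := hl.trans (by rw [hΛ]; gcongr)
  have hlp := h.lam_pos
  have hb : ∀ k : ℕ, K ≤ k → θ/2*k ≤ c k - lam := by
    intro k hk
    have := H.lower 0 k
    rw [zero_add, H.c0] at this
    have h2 : (K:ℝ) ≤ k := by exact_mod_cast hk
    nlinarith
  have haN : a N ≤ S := by
    have h1 := h.top
    have h2 := hb N hKN
    have h3 : (N:ℝ) - ρ ≤ S * (c N - lam) := by
      have : S * (θ/2*N) ≤ S * (c N - lam) := mul_le_mul_of_nonneg_left h2 (by linarith)
      have : (0:ℝ) ≤ N := by positivity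
      nlinarith
    have h4 : 0 < c N - lam := sub_pos.2 h.lam_lt
    nlinarith
  have hright : ∀ i k : ℕ, k + i = N → K ≤ k + 1 → a k ≤ S := by
    intro i
    induction i with
    | zero => intro k hk _; simp at hk; subst hk; exact haN
    | succ n ih =>
      intro k hk hk1
      have h1 := ih (k+1) (by omega) (by omega)
      have h2 := h.step k
      have h3 := hb (k+1) hk1
      have h4 := H.cpos k
      have h5 : lam * a (k+1) ≤ lam * S := mul_le_mul_of_nonneg_left h1 hlp.le
      have h6 := mul_le_mul_of_nonneg_left h3 (show 0 ≤ S by linarith)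
      have h7 : (0:ℝ) ≤ k := by positivity
      push_cast at *
      have h8 : c (k+1) * a k ≤ c (k+1) * S := by nlinarith
      exact le_of_mul_le_mul_left h8 h4
  have hleft : ∀ i k : ℕ, k + i = K → a k ≤ S * q^i := by
    intro i
    induction i with
    | zero => intro k hk; simp at hk; subst hk; simpa using hright (N-k) k (by omega) (by omega)
    | succ n ih =>
      intro k hk
      have h1 := ih (k+1) (by omega)
      have h2 := h.step k
      have h4 := H.cpos k
      have h3 := H.cmin (k+1) (by omega)
      have hX : 1 ≤ S * q^n := one_le_mul_of_one_le_of_one_le hS1 (one_le_pow₀ hq1)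
      set X := S * q^n
      have hkK : (k:ℝ)+1 ≤ K := by exact_mod_cast (show k+1 ≤ K by omega)
      have h0 := h.pos (k+1) (by omega)
      have h5 : lam * a (k+1) ≤ Λ * X := mul_le_mul hl' h1 h0.le hΛ0.le
      have h0' := h.pos k (by omega)
      have h6 : κ * a k ≤ c (k+1) * a k := mul_le_mul_of_nonneg_right h3 h0'.le
      have h7 : κ * a k ≤ κ * (X * q) := by
        have : (K:ℝ) ≤ K * X := le_mul_of_one_le_right (by positivity) hX
        nlinarith
      rw [pow_succ, ← mul_assoc]
      exact le_of_mul_le_mul_left h7 hκ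
  have hup : ∀ k ≤ N, a k ≤ S * q^K := by
    intro k hk
    rcases le_total K k with h1 | h1
    · refine (hright (N-k) k (by omega) (by omega)).trans ?_
      exact le_mul_of_one_le_right (by linarith) (one_le_pow₀ hq1)
    · refine (hleft (K-k) k (by omega)).trans ?_
      refine mul_le_mul_of_nonneg_left (pow_le_pow_right₀ hq1 (by omega)) (by linarith)
  have hlow1 : ∀ k : ℕ, k < N → ρ ≤ k → m₁ ≤ a k := by
    intro k hk hρk
    have h2 := h.step k
    have h4 := H.cpos k
    have h5 := H.cle (k+1)
    have h6 := mul_pos hlp (h.pos (k+1) (by omega))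
    have h7 := h.pos k hk.le
    push_cast at *
    have h8' := mul_le_mul_of_nonneg_right h5 h7.le
    have h8 : (k:ℝ) + 1 - ρ ≤ a₁ * (k+1) * a k := by linarith
    have h9 : (k:ℝ)+1 ≤ (1+ρ₀) * ((k:ℝ)+1-ρ) := by
      have e1 : 0 ≤ (ρ₀ - ρ) * ((k:ℝ)+1-ρ) := mul_nonneg (by linarith) (by linarith)
      have e2 : 0 ≤ ρ * (k - ρ) := mul_nonneg (by linarith) (by linarith)
      linarith
    rw [hm₁, div_le_iff₀ (by positivity)]
    have h11 := mul_le_mul_of_nonneg_left h8 (show 0 ≤ 1 + ρ₀ by linarith)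
    have h12 : 0 ≤ ((k:ℝ)+1) * (a k * (a₁*(1+ρ₀))) := by positivity
    have h10 : ((k:ℝ)+1) * 1 ≤ (k+1) * (a k * (2*a₁*(1+ρ₀))) := by linarith
    exact le_of_mul_le_mul_left h10 (by positivity)
  have hlow2 : ∀ k : ℕ, (k:ℝ) ≤ ρ → 1/(4*a₁) * r^k ≤ a k := by
    intro k
    induction k with
    | zero =>
      intro _
      rw [pow_zero, mul_one, div_le_iff₀ (by positivity)]
      have := h.zero
      have h0 := h.pos 0 (by omega)
      have : lam * 1 ≤ lam * (a 0 * (4*a₁)) := by nlinarith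
      exact le_of_mul_le_mul_left this hlp
    | succ n ih =>
      intro hn
      push_cast at hn
      have h1 := ih (by linarith)
      have h2 := h.step n
      have h3 := H.cmin (n+1) (by omega)
      have hnN : n ≤ N := by
        have : (n:ℝ) ≤ N := by linarith
        exact_mod_cast this
      have h0 := h.pos n hnN
      have h4 : lam * (r * a n) ≤ lam * a (n+1) := by
        have h5 : lam * r ≤ κ := by nlinarith
        have h6 : lam * r * a n ≤ c (n+1) * a n := mul_le_mul_of_nonneg_right (h5.trans h3) h0.le
        linarith
      have h5 := le_of_mul_le_mul_left h4 hlp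
      rw [pow_succ]
      have h6 := mul_le_mul_of_nonneg_left h1 hr0.le
      linarith
  intro k hk
  refine ⟨?_, hup k hk⟩
  rcases le_total (k:ℝ) ρ with h1 | h1
  · refine (min_le_right _ _).trans (le_trans ?_ (hlow2 k h1))
    rw [hm₂]
    have : k ≤ ⌈ρ₀⌉₊ := by
      have : (k:ℝ) ≤ ⌈ρ₀⌉₊ := (h1.trans hρρ).trans (Nat.le_ceil _)
      exact_mod_cast this
    exact mul_le_mul_of_nonneg_left (pow_le_pow_of_le_one hr0.le hr1 this) (by positivity)
  · refine (min_le_left _ _).trans ?_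
    rcases Nat.lt_or_ge k N with h2 | h2
    · exact hlow1 k h2 h1
    · have : k = N := by omega
      subst this
      rw [← h.topeq]
      rcases Nat.lt_or_ge 1 k with h3 | h3
      · refine hlow1 _ (by omega) ?_
        have : ((k-1:ℕ):ℝ) = k - 1 := by rw [Nat.cast_sub hN]; simp
        rw [this]
        have : (2:ℝ) ≤ k := by exact_mod_cast h3
        linarith
      · have : k = 1 := by omega
        subst this
        have h2 := h.step 0
        have h4 := H.cpos 0
        have h5 := H.cle 1
        have h6 := mul_pos hlp (h.pos 1 le_rfl)
        have h7 := h.pos 0 (by omega)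
        have h8 := h.topeq
        have h9 := h.top
        have h10 := h.lam_lt
        rw [hm₁, div_le_iff₀ (by positivity)]
        norm_num at h8 h9 h2 h5 hρN h6
        have e1 : c 1 * a 0 ≤ a₁ * a 0 := mul_le_mul_of_nonneg_right h5 h7.le
        have e2 : 0 ≤ a₁ * a 0 * ρ₀ := by positivity
        norm_num
        linarith


lemma growth_up (x : ℕ → ℝ) (t : ℝ) (ht : 0 ≤ t) (n : ℕ) (hx : 0 ≤ x 0)
    (h : ∀ i < n, x (i+1) ≤ (1+t) * x i) : ∀ i ≤ n, x i ≤ Real.exp (t * n) * x 0 := by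
  have key : ∀ i ≤ n, x i ≤ Real.exp (t * i) * x 0 := by
    intro i
    induction i with
    | zero => intro _; simp
    | succ k ih =>
      intro hk
      have h1 := ih (by omega)
      have h2 := h k (by omega)
      have h3 : 1 + t ≤ Real.exp t := by linarith [Real.add_one_le_exp t]
      have h4 : (1+t) * x k ≤ (1+t) * (Real.exp (t*k) * x 0) :=
        mul_le_mul_of_nonneg_left h1 (by linarith)
      have h5 : (1+t) * (Real.exp (t*k) * x 0) ≤ Real.exp t * (Real.exp (t*k) * x 0) :=
        mul_le_mul_of_nonneg_right h3 (by positivity)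
      have e : Real.exp (t * ((k+1:ℕ):ℝ)) = Real.exp t * Real.exp (t*k) := by
        rw [← Real.exp_add]; push_cast; ring_nf
      rw [e, mul_assoc]; linarith
  intro i hi
  refine (key i hi).trans (mul_le_mul_of_nonneg_right (Real.exp_le_exp.2 ?_) hx)
  have : (i:ℝ) ≤ n := by exact_mod_cast hi
  exact mul_le_mul_of_nonneg_left this ht

lemma growth_dn (x : ℕ → ℝ) (t : ℝ) (ht : 0 ≤ t) (n : ℕ) (hx : ∀ i ≤ n, 0 ≤ x i)
    (h : ∀ i < n, x i ≤ (1+t) * x (i+1)) : ∀ i ≤ n, x 0 ≤ Real.exp (t * n) * x i := by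
  have key : ∀ i ≤ n, x 0 ≤ Real.exp (t * i) * x i := by
    intro i
    induction i with
    | zero => intro _; simp
    | succ k ih =>
      intro hk
      have h1 := ih (by omega)
      have h2 := h k (by omega)
      have h3 : 1 + t ≤ Real.exp t := by linarith [Real.add_one_le_exp t]
      have h0 := hx (k+1) hk
      have h4 : Real.exp (t*k) * x k ≤ Real.exp (t*k) * (Real.exp t * x (k+1)) :=
        mul_le_mul_of_nonneg_left (h2.trans (mul_le_mul_of_nonneg_right h3 h0)) (by positivity)
      have e : Real.exp (t * ((k+1:ℕ):ℝ)) = Real.exp (t*k) * Real.exp t := by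
        rw [← Real.exp_add]; push_cast; ring_nf
      rw [e, mul_assoc]; linarith
  intro i hi
  refine (key i hi).trans (mul_le_mul_of_nonneg_right (Real.exp_le_exp.2 ?_) (hx i hi))
  have : (i:ℝ) ≤ n := by exact_mod_cast hi
  exact mul_le_mul_of_nonneg_left this ht

lemma lam_upper {c : ℕ → ℝ} {a₁ θ B κ : ℝ} (H : CH c a₁ θ B κ) (N : ℕ) (ρ lam : ℝ) (a : ℕ → ℝ)
    (hN : 1 ≤ N) (hρ : 0 < ρ) (hρN : 2 * ρ ≤ N) (h : SiteSol c N ρ lam a)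
    (n q : ℕ) (W : ℝ) (hn1 : (n:ℝ) ≤ ρ) (hn2 : ρ < n + 1) (hW1 : θ + B ≤ W) (hW2 : a₁ * q ≤ W)
    (hnq : n + q ≤ N) (hq : 8 * a₁ * ρ ≤ θ * (q * (q - 1))) : lam ≤ c n + W := by
  by_contra hcon
  push Not at hcon
  have hθ := H.th_pos
  have hlp := h.lam_pos
  have ha₁ := H.a1_pos
  have hb : ∀ k ≤ n, ρ - k ≤ (1/θ) * (lam - c k) := by
    intro k hk
    obtain ⟨i, rfl⟩ := Nat.exists_eq_add_of_le hk
    have h1 := H.lower k i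
    push_cast at *
    rw [one_div, inv_mul_eq_div, le_div_iff₀ hθ]
    nlinarith
  have hleft : ∀ k ≤ n, lam * a k ≤ lam * (1/θ) := by
    intro k
    induction k with
    | zero =>
      intro _
      have := hb 0 (by omega)
      rw [H.c0] at this
      rw [h.zero]; push_cast at this; linarith
    | succ k ih =>
      intro hk
      have h1 := le_of_mul_le_mul_left (ih (by omega)) hlp
      have h2 := hb (k+1) hk
      have h3 := h.step k
      have h4 := mul_le_mul_of_nonneg_left h1 (H.cpos k).le
      push_cast at h2
      linarith
  have hright : ∀ i ≤ q, lam * a (n+i) ≤ lam * (1/θ) - i * (i-1) / 2 := by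
    intro i
    induction i with
    | zero => intro _; simpa using hleft n le_rfl
    | succ i ih =>
      intro hi
      have h1 := ih (by omega)
      have h2 := h.step (n+i)
      have h3 := (abs_le.1 (H.lip n (i+1))).2
      have h4 : a₁ * ((i+1:ℕ):ℝ) ≤ a₁ * q :=
        mul_le_mul_of_nonneg_left (by exact_mod_cast hi) ha₁.le
      have h5 := h.pos (n+i) (by omega)
      rw [show n + (i+1) = n+i+1 by ring] at *
      have h6 : c (n+i+1) ≤ lam := by linarith
      have h7 := mul_le_mul_of_nonneg_right h6 h5.le
      push_cast at *
      linarith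
  have h1 := hright q le_rfl
  have h2 := mul_pos hlp (h.pos (n+q) hnq)
  have h3 := H.lamle N ρ lam a hN hρ hρN h
  have h4 : lam * (1/θ) ≤ q * (q-1)/2 := by
    rw [mul_one_div, div_le_iff₀ hθ]; linarith
  linarith

lemma lam_lower {c : ℕ → ℝ} {a₁ θ B κ : ℝ} (H : CH c a₁ θ B κ) (N : ℕ) (ρ lam : ℝ) (a : ℕ → ℝ)
    (hN : 1 ≤ N) (hρ : 0 < ρ) (hρN : 2 * ρ ≤ N) (h : SiteSol c N ρ lam a)
    (n q : ℕ) (W : ℝ) (hn1 : (n:ℝ) ≤ ρ) (hW1 : θ + B ≤ W) (hW2 : a₁ * q ≤ W)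
    (hnN : n ≤ N) (hnq : q ≤ n) (hq : 8 * a₁ * ρ ≤ θ * (q * (q - 1))) : c n - W ≤ lam := by
  by_contra hcon
  push Not at hcon
  have hθ := H.th_pos
  have hlp := h.lam_pos
  have ha₁ := H.a1_pos
  have hb : ∀ k, n ≤ k → k - ρ ≤ (1/θ) * (c k - lam) := by
    intro k hk
    obtain ⟨i, rfl⟩ := Nat.exists_eq_add_of_le hk
    have h1 := H.lower n i
    push_cast at *
    rw [one_div, inv_mul_eq_div, le_div_iff₀ hθ]
    nlinarith
  have hright : ∀ i k, k + i = N → n ≤ k → a k ≤ 1/θ := by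
    intro i
    induction i with
    | zero =>
      intro k hk hnk
      simp at hk; subst hk
      have h1 := hb k hnk
      have h2 := h.top
      exact le_of_mul_le_mul_left (a := c k - lam) (by linarith) (sub_pos.2 h.lam_lt)
    | succ i ih =>
      intro k hk hnk
      have h1 := ih (k+1) (by omega) (by omega)
      have h2 := hb (k+1) (by omega)
      have h3 := h.step k
      have h4 := mul_le_mul_of_nonneg_left h1 hlp.le
      push_cast at h2
      exact le_of_mul_le_mul_left (a := c (k+1)) (by linarith) (H.cpos k)
  have hleft : ∀ i k, k + i = n → i ≤ q → lam * a k ≤ lam * (1/θ) - i * (i-1) / 2 := by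
    intro i
    induction i with
    | zero =>
      intro k hk _
      simp at hk; subst hk
      have := mul_le_mul_of_nonneg_left (hright (N-k) k (by omega) le_rfl) hlp.le
      simpa using this
    | succ i ih =>
      intro k hk hi
      have h1 := ih (k+1) (by omega) (by omega)
      have h2 := h.step k
      have h3 := (abs_le.1 (H.lip (k+1) i)).2
      rw [show k + 1 + i = n by omega] at h3
      have h4 : a₁ * (i:ℝ) ≤ a₁ * q :=
        mul_le_mul_of_nonneg_left (by exact_mod_cast (by omega : i ≤ q)) ha₁.le
      have h5 := h.pos k (by omega)
      have h6 : lam ≤ c (k+1) := by linarith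
      have h7 := mul_le_mul_of_nonneg_right h6 h5.le
      have h8 : (k:ℝ) + (i+1) = n := by exact_mod_cast hk
      push_cast
      linarith
  have h1 := hleft q (n-q) (by omega) le_rfl
  have h2 := mul_pos hlp (h.pos (n-q) (by omega))
  have h3 := H.lamle N ρ lam a hN hρ hρN h
  have h4 : lam * (1/θ) ≤ q * (q-1)/2 := by
    rw [mul_one_div, div_le_iff₀ hθ]; linarith
  linarith

/-- window data -/
structure Win (c : ℕ → ℝ) (θ W w C₃ : ℝ) (N : ℕ) (ρ lam r : ℝ) (kL kR : ℕ) : Prop where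
  r1 : 1 ≤ r
  LR : kL ≤ kR
  RN : kR ≤ N
  width : (kR:ℝ) - kL ≤ w * r
  left : ∀ k ≤ kL, θ/2*(ρ-k) ≤ lam - c k ∧ lam - c k ≤ C₃*(ρ-k) ∧ W*r ≤ ρ-k
  right : ∀ k, kR ≤ k → θ/2*(k-ρ) ≤ c k - lam ∧ c k - lam ≤ C₃*(k-ρ) ∧ W*r ≤ k-ρ
  mid1 : ∀ k, kL ≤ k → k ≤ kR → c k ≤ (1+w/r)*lam
  mid2 : ∀ k, kL ≤ k → k ≤ kR → lam ≤ (1+w/r)*c k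
  mid3 : ∀ k : ℕ, kL ≤ k → k ≤ kR → |(k:ℝ)-ρ| ≤ w/r*lam
  rl : r ≤ w/r*lam

set_option maxHeartbeats 1000000 in
lemma exists_win {c : ℕ → ℝ} {a₁ θ B κ : ℝ} (H : CH c a₁ θ B κ) :
    ∃ r₀ W w C₃ : ℝ, 1 ≤ r₀ ∧ 0 < W ∧ 0 < w ∧ 0 < C₃ ∧
    ∀ (N : ℕ) (ρ lam r : ℝ) (a : ℕ → ℝ), 1 ≤ N → 2 * ρ ≤ N → r₀ ≤ r → ρ = r^2 →
      SiteSol c N ρ lam a → ∃ kL kR, Win c θ W w C₃ N ρ lam r kL kR := by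
  have hθ := H.th_pos
  have ha₁ := H.a1_pos
  have hB := H.B_nonneg
  obtain ⟨g, hg⟩ : ∃ g, g = 2 + 16*a₁/θ := ⟨_, rfl⟩
  have hg0 : 0 < 16*a₁/θ := by positivity
  have hg2 : 2 ≤ g := by linarith
  have hgθ : 16*a₁ ≤ θ * g^2 := by
    have e : θ * (16*a₁/θ) = 16 * a₁ := by field_simp
    have : 16*a₁/θ ≤ g^2 := by nlinarith
    calc _ = θ * (16*a₁/θ) := e.symm
      _ ≤ _ := mul_le_mul_of_nonneg_left this hθ.le
  obtain ⟨W₁, hW₁⟩ : ∃ W₁, W₁ = a₁*(g+1) + θ + B := ⟨_, rfl⟩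
  have hag : 0 < a₁*(g+1) := by positivity
  have hW₁0 : 0 < W₁ := by linarith
  obtain ⟨W, hW⟩ : ∃ W, W = 2*(θ+B+W₁)/θ := ⟨_, rfl⟩
  have hWθ : θ * W = 2*(θ+B+W₁) := by rw [hW]; field_simp
  have hW2 : 2 ≤ W := by
    rw [hW, le_div_iff₀ hθ]; linarith
  obtain ⟨w₀, hw₀⟩ : ∃ w₀, w₀ = a₁*(W+2)+W₁ := ⟨_, rfl⟩
  have hw₀0 : 0 < w₀ := by rw [hw₀]; positivity
  obtain ⟨w, hw⟩ : ∃ w, w = 4*w₀/θ + 2*(W+1)/θ + 2/θ + 2*W + 2 := ⟨_, rfl⟩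
  have e1 : 0 < 4*w₀/θ := by positivity
  have e2 : 0 < 2*(W+1)/θ := by positivity
  have e3 : 0 < 2/θ := by positivity
  have f1 : 4*w₀ ≤ w*θ := by rw [← div_le_iff₀ hθ]; linarith
  have f2 : 2*(W+1) ≤ w*θ := by rw [← div_le_iff₀ hθ]; linarith
  have f3 : 2 ≤ w*θ := by rw [← div_le_iff₀ hθ]; linarith
  have f4 : 2*W+2 ≤ w := by linarith
  have hw0 : 0 < w := by linarith
  refine ⟨g + 2 + W + 4*w₀/θ, W, w, 2*a₁+W₁, by linarith, by linarith, hw0, by linarith, ?_⟩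
  intro N ρ lam r a hN hρN hr hρr h
  have hr1 : 1 ≤ r := by linarith
  have hr0 : 0 < r := by linarith
  have hrg : g + 2 ≤ r := by linarith
  have hrW : W ≤ r := by linarith
  have hrw : 4*w₀ ≤ r*θ := by rw [← div_le_iff₀ hθ]; linarith
  have hρ : 0 < ρ := by rw [hρr]; positivity
  obtain ⟨n, hn1, hn2⟩ : ∃ n : ℕ, (n:ℝ) ≤ ρ ∧ ρ < n+1 :=
    ⟨⌊ρ⌋₊, Nat.floor_le hρ.le, Nat.lt_floor_add_one ρ⟩
  obtain ⟨q, hq1, hq2⟩ : ∃ q : ℕ, g*r ≤ q ∧ (q:ℝ) < g*r+1 :=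
    ⟨⌈g*r⌉₊, Nat.le_ceil _, Nat.ceil_lt_add_one (by positivity)⟩
  have hgr : 2 ≤ g*r := by
    have : 2*1 ≤ g*r := mul_le_mul hg2 hr1 (by norm_num) (by linarith)
    linarith
  have hqn : q ≤ n := by
    have h1 : (g+2)*r ≤ r*r := mul_le_mul_of_nonneg_right hrg hr0.le
    have h2 : ρ = r*r := by rw [hρr, sq]
    have : (q:ℝ) < n+1 := by linarith
    have : q < n+1 := by exact_mod_cast this
    omega
  have hnN : n + q ≤ N := by
    have : (n:ℝ) + n ≤ N := by linarith
    have : n + n ≤ N := by exact_mod_cast this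
    omega
  have hqq : 8*a₁*ρ ≤ θ*(q*(q-1)) := by
    have h1 : g*r*(g*r/2) ≤ q*(q-1) := mul_le_mul hq1 (by linarith) (by linarith) (by linarith)
    have h2 := mul_le_mul_of_nonneg_left h1 hθ.le
    have h3 := mul_le_mul_of_nonneg_right hgθ (sq_nonneg r)
    rw [hρr]; linarith
  have hWq : a₁ * q ≤ W₁*r := by
    have h1 : a₁ * q ≤ a₁*(g*r+r) := mul_le_mul_of_nonneg_left (by linarith) ha₁.le
    have h2 : a₁*(g+1)*r ≤ W₁*r := mul_le_mul_of_nonneg_right (by linarith) hr0.le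
    linarith
  have hWB : θ + B ≤ W₁*r := by
    have : W₁ * 1 ≤ W₁ * r := mul_le_mul_of_nonneg_left hr1 hW₁0.le
    linarith
  have hlu := lam_upper H N ρ lam a hN hρ hρN h n q (W₁*r) hn1 hn2 hWB hWq hnN hqq
  have hll := lam_lower H N ρ lam a hN hρ hρN h n q (W₁*r) hn1 hWB hWq (by omega) hqn hqq
  have hlam : θ/2*r^2 ≤ lam := by
    have h1 := H.lower 0 n
    rw [zero_add, H.c0] at h1
    have h3 : θ*(r^2-1) ≤ θ*n := mul_le_mul_of_nonneg_left (by linarith) hθ.le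
    have h4 : θ*W*r ≤ θ*r*r :=
      mul_le_mul_of_nonneg_right (mul_le_mul_of_nonneg_left hrW hθ.le) hr0.le
    rw [hWθ] at h4
    have h5 : (θ+B)*1 ≤ (θ+B)*r := mul_le_mul_of_nonneg_left hr1 (by linarith)
    linarith
  have hgen : ∀ k : ℕ, |c k - lam| ≤ a₁*(|(k:ℝ)-ρ|+1) + W₁*r := by
    intro k
    have h1 : |c k - c n| ≤ a₁*|(k:ℝ)-n| := by
      rcases le_total n k with h1 | h1
      · obtain ⟨i, rfl⟩ := Nat.exists_eq_add_of_le h1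
        have := H.lip n i
        push_cast; rw [add_sub_cancel_left, Nat.abs_cast]; exact this
      · obtain ⟨i, rfl⟩ := Nat.exists_eq_add_of_le h1
        have := H.lip k i
        push_cast; rw [abs_sub_comm, abs_sub_comm (k:ℝ), add_sub_cancel_left, Nat.abs_cast]
        exact this
    have h2 : |(k:ℝ)-n| ≤ |(k:ℝ)-ρ| + 1 := by
      have := abs_add_le ((k:ℝ)-ρ) (ρ-n)
      have h3 : |ρ-n| ≤ 1 := abs_le.2 ⟨by linarith, by linarith⟩
      rw [show (k:ℝ)-ρ+(ρ-n) = k-n by ring] at this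
      linarith
    have h3 : |c n - lam| ≤ W₁*r := abs_le.2 ⟨by linarith, by linarith⟩
    have h4 := abs_add_le (c k - c n) (c n - lam)
    rw [show c k - c n+(c n-lam) = c k-lam by ring] at h4
    have h5 := mul_le_mul_of_nonneg_left h2 ha₁.le
    linarith
  have hWr : W*r ≤ ρ := by rw [hρr, sq]; exact mul_le_mul_of_nonneg_right hrW hr0.le
  obtain ⟨kL, hL1, hL2⟩ : ∃ n : ℕ, (n:ℝ) ≤ ρ-W*r ∧ ρ-W*r < n+1 :=
    ⟨⌊ρ-W*r⌋₊, Nat.floor_le (by linarith), Nat.lt_floor_add_one _⟩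
  obtain ⟨kR, hR1, hR2⟩ : ∃ q : ℕ, ρ+W*r ≤ q ∧ (q:ℝ) < ρ+W*r+1 :=
    ⟨⌈ρ+W*r⌉₊, Nat.le_ceil _, Nat.ceil_lt_add_one (by positivity)⟩
  have hWr0 : 2*1 ≤ W*r := mul_le_mul hW2 hr1 (by norm_num) (by linarith)
  have hrr : r ≤ W*r := by
    have := mul_le_mul_of_nonneg_right hW2 hr0.le
    linarith
  have har : a₁*1 ≤ a₁*r := mul_le_mul_of_nonneg_left hr1 ha₁.le
  have hWr3 : 2*(θ+B+W₁*r) ≤ θ*(W*r) := by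
    have h5 : (θ+B)*1 ≤ (θ+B)*r := mul_le_mul_of_nonneg_left hr1 (by linarith)
    rw [← mul_assoc, hWθ]; linarith
  have hmid0 : ∀ k : ℕ, kL ≤ k → k ≤ kR → |(k:ℝ)-ρ| ≤ (W+1)*r := by
    intro k h1 h2
    have h1' : (kL:ℝ) ≤ k := by exact_mod_cast h1
    have h2' : (k:ℝ) ≤ kR := by exact_mod_cast h2
    exact abs_le.2 ⟨by linarith, by linarith⟩
  have hmidc : ∀ k : ℕ, kL ≤ k → k ≤ kR → |c k-lam| ≤ w₀*r := by
    intro k h1 h2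
    have h3 := hgen k
    have h4 := mul_le_mul_of_nonneg_left (hmid0 k h1 h2) ha₁.le
    rw [hw₀]; linarith
  have hconv : ∀ v y z : ℝ, v*r ≤ y → θ/2*r^2 ≤ z → 2*v ≤ w*θ → v*r ≤ w/r*z := by
    intro v y z _ h2 h3
    have : w/r*(θ/2*r^2) ≤ w/r*z := mul_le_mul_of_nonneg_left h2 (by positivity)
    have e : w/r*(θ/2*r^2) = w*θ/2*r := by field_simp
    have h4 := mul_le_mul_of_nonneg_right h3 hr0.le
    linarith
  refine ⟨kL, kR, hr1, ?_, ?_, ?_, ?_, ?_, ?_, ?_, ?_, ?_⟩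
  · have : (kL:ℝ) ≤ kR := by linarith
    exact_mod_cast this
  · have : (kR:ℝ) < N+1 := by linarith
    have : kR < N+1 := by exact_mod_cast this
    omega
  · have := mul_le_mul_of_nonneg_right f4 hr0.le
    linarith
  · intro k hk
    have hk' : (k:ℝ) ≤ kL := by exact_mod_cast hk
    have hkn : k ≤ n := by
      have : (k:ℝ) < n+1 := by linarith
      have : k < n+1 := by exact_mod_cast this
      omega
    have hg1 := (abs_le.1 (hgen k)).1
    rw [abs_of_nonpos (by linarith)] at hg1
    have hX : W*r ≤ ρ - k := by linarith
    refine ⟨?_, ?_, hX⟩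
    · obtain ⟨i, rfl⟩ := Nat.exists_eq_add_of_le hkn
      have h1 := H.lower k i
      have h2 := mul_le_mul_of_nonneg_left hX hθ.le
      push_cast at hn2 hn1 h1 ⊢
      have h3 : θ*(ρ-1-k) ≤ θ*i := mul_le_mul_of_nonneg_left (by linarith) hθ.le
      linarith
    · have h3 : a₁*1 ≤ a₁*(ρ-k) := mul_le_mul_of_nonneg_left (by linarith) ha₁.le
      have h4 : W₁*r ≤ W₁*(ρ-k) := mul_le_mul_of_nonneg_left (by linarith) hW₁0.le
      linarith
  · intro k hk
    have hk' : (kR:ℝ) ≤ k := by exact_mod_cast hk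
    have hkn : n ≤ k := by
      have : (n:ℝ) ≤ k := by linarith
      exact_mod_cast this
    have hg1 := (abs_le.1 (hgen k)).2
    rw [abs_of_nonneg (by linarith)] at hg1
    have hX : W*r ≤ k - ρ := by linarith
    refine ⟨?_, ?_, hX⟩
    · obtain ⟨i, rfl⟩ := Nat.exists_eq_add_of_le hkn
      have h1 := H.lower n i
      have h2 := mul_le_mul_of_nonneg_left hX hθ.le
      push_cast at h2 h1 ⊢
      have h3 : θ*(n+i-ρ) ≤ θ*i := mul_le_mul_of_nonneg_left (by linarith) hθ.le
      linarith
    · have h3 : a₁*1 ≤ a₁*(k-ρ) := mul_le_mul_of_nonneg_left (by linarith) ha₁.le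
      have h4 : W₁*r ≤ W₁*(k-ρ) := mul_le_mul_of_nonneg_left (by linarith) hW₁0.le
      linarith
  · intro k h1 h2
    have h3 := (abs_le.1 (hmidc k h1 h2)).2
    have := hconv w₀ _ lam le_rfl hlam (by linarith)
    linarith
  · intro k h1 h2
    have h3 := (abs_le.1 (hmidc k h1 h2)).1
    have h5 := mul_le_mul_of_nonneg_right hrw hr0.le
    have h6 := mul_le_mul_of_nonneg_right f1 hr0.le
    have h4 : θ/4*r^2 ≤ c k := by linarith
    have : w/r*(θ/4*r^2) ≤ w/r*c k := mul_le_mul_of_nonneg_left h4 (by positivity)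
    have e : w/r*(θ/4*r^2) = w*θ/4*r := by field_simp
    linarith
  · intro k h1 h2
    exact (hmid0 k h1 h2).trans (hconv (W+1) _ lam le_rfl hlam (by linarith))
  · have := hconv 1 _ lam le_rfl hlam (by linarith)
    linarith


section
variable {c : ℕ → ℝ} {a₁ θ B κ W w C₃ ρ lam r : ℝ} {N kL kR : ℕ} {a : ℕ → ℝ}

lemma win_LR (hW : 0 < W) (V : Win c θ W w C₃ N ρ lam r kL kR) : kL + 1 ≤ kR := by
  have h1 := (V.left kL le_rfl).2.2
  have h2 := (V.right kR le_rfl).2.2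
  have h3 : 0 < W * r := mul_pos hW (by linarith [V.r1])
  have : (kL:ℝ) < kR := by linarith
  exact_mod_cast this

lemma win_upL (H : CH c a₁ θ B κ) (h : SiteSol c N ρ lam a)
    (V : Win c θ W w C₃ N ρ lam r kL kR) : ∀ k ≤ kL, a k ≤ 2/θ := by
  have hθ := H.th_pos
  have hS0 : 0 < 2/θ := by positivity
  have hS : ∀ x, 2/θ*(θ/2*x) = x := by intro x; field_simp
  have hb : ∀ k ≤ kL, ρ - k ≤ 2/θ*(lam - c k) := by
    intro k hk
    have := mul_le_mul_of_nonneg_left (V.left k hk).1 hS0.le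
    rwa [hS] at this
  intro k
  induction k with
  | zero =>
    intro h0
    have h1 := hb 0 h0
    have h2 := h.zero
    rw [H.c0] at h1; push_cast at h1
    exact le_of_mul_le_mul_left (a := lam) (by linarith) h.lam_pos
  | succ k ih =>
    intro hk
    have h1 := hb _ hk
    have h2 := h.step k
    have h3 := mul_le_mul_of_nonneg_left (ih (by omega)) (H.cpos k).le
    push_cast at h1
    exact le_of_mul_le_mul_left (a := lam) (by linarith) h.lam_pos

lemma win_loL (H : CH c a₁ θ B κ) (hC : 0 < C₃) (h : SiteSol c N ρ lam a)
    (V : Win c θ W w C₃ N ρ lam r kL kR) : ∀ k ≤ kL, 1/C₃ ≤ a k := by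
  have hS0 : 0 < 1/C₃ := by positivity
  have hS : ∀ x, 1/C₃*(C₃*x) = x := by intro x; field_simp
  have hb : ∀ k ≤ kL, 1/C₃*(lam - c k) ≤ ρ - k := by
    intro k hk
    have := mul_le_mul_of_nonneg_left (V.left k hk).2.1 hS0.le
    rwa [hS] at this
  intro k
  induction k with
  | zero =>
    intro h0
    have h1 := hb 0 h0
    have h2 := h.zero
    rw [H.c0] at h1; push_cast at h1
    exact le_of_mul_le_mul_left (a := lam) (by linarith) h.lam_pos
  | succ k ih =>
    intro hk
    have h1 := hb _ hk
    have h2 := h.step k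
    have h3 := mul_le_mul_of_nonneg_left (ih (by omega)) (H.cpos k).le
    push_cast at h1
    exact le_of_mul_le_mul_left (a := lam) (by linarith) h.lam_pos

lemma win_upR (H : CH c a₁ θ B κ) (h : SiteSol c N ρ lam a)
    (V : Win c θ W w C₃ N ρ lam r kL kR) : ∀ i k, k + i = N → kR ≤ k + 1 → a k ≤ 2/θ := by
  have hθ := H.th_pos
  have hS0 : 0 < 2/θ := by positivity
  have hS : ∀ x, 2/θ*(θ/2*x) = x := by intro x; field_simp
  have hb : ∀ k : ℕ, kR ≤ k → k - ρ ≤ 2/θ*(c k - lam) := by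
    intro k hk
    have := mul_le_mul_of_nonneg_left (V.right k hk).1 hS0.le
    rwa [hS] at this
  intro i
  induction i with
  | zero =>
    intro k hk _
    simp at hk; subst hk
    have h1 := hb k V.RN
    have h2 := h.top
    exact le_of_mul_le_mul_left (a := c k - lam) (by linarith) (sub_pos.2 h.lam_lt)
  | succ i ih =>
    intro k hk hkR
    have h1 := hb _ hkR
    have h2 := h.step k
    have h3 := mul_le_mul_of_nonneg_left (ih (k+1) (by omega) (by omega)) h.lam_pos.le
    push_cast at h1
    exact le_of_mul_le_mul_left (a := c (k+1)) (by linarith) (H.cpos k)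

lemma win_loR (H : CH c a₁ θ B κ) (hC : 0 < C₃) (h : SiteSol c N ρ lam a)
    (V : Win c θ W w C₃ N ρ lam r kL kR) : ∀ i k, k + i = N → kR ≤ k + 1 → 1/C₃ ≤ a k := by
  have hS0 : 0 < 1/C₃ := by positivity
  have hS : ∀ x, 1/C₃*(C₃*x) = x := by intro x; field_simp
  have hb : ∀ k : ℕ, kR ≤ k → 1/C₃*(c k - lam) ≤ k - ρ := by
    intro k hk
    have := mul_le_mul_of_nonneg_left (V.right k hk).2.1 hS0.le
    rwa [hS] at this
  intro i
  induction i with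
  | zero =>
    intro k hk _
    simp at hk; subst hk
    have h1 := hb k V.RN
    have h2 := h.top
    exact le_of_mul_le_mul_left (a := c k - lam) (by linarith) (sub_pos.2 h.lam_lt)
  | succ i ih =>
    intro k hk hkR
    have h1 := hb _ hkR
    have h2 := h.step k
    have h3 := mul_le_mul_of_nonneg_left (ih (k+1) (by omega) (by omega)) h.lam_pos.le
    push_cast at h1
    exact le_of_mul_le_mul_left (a := c (k+1)) (by linarith) (H.cpos k)

lemma win_exp (hw : 0 < w) (V : Win c θ W w C₃ N ρ lam r kL kR) (n : ℕ) (hn : n ≤ kR - kL) :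
    Real.exp (w/r * n) ≤ Real.exp (w^2) := by
  have hr : 0 < r := by linarith [V.r1]
  have h1 : (n:ℝ) ≤ kR - kL := by
    have h2 := V.LR
    have h3 : n + kL ≤ kR := by omega
    have : (n:ℝ) + kL ≤ kR := by exact_mod_cast h3
    linarith
  refine Real.exp_le_exp.2 ?_
  calc w/r*n ≤ w/r*(w*r) := mul_le_mul_of_nonneg_left (h1.trans V.width) (by positivity)
    _ = w^2 := by field_simp

lemma win_upM (H : CH c a₁ θ B κ) (hw : 0 < w) (h : SiteSol c N ρ lam a)
    (V : Win c θ W w C₃ N ρ lam r kL kR) :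
    ∀ k, kL ≤ k → k ≤ kR → a k ≤ Real.exp (w^2) * (2/θ+1) := by
  have hr : 0 < r := by linarith [V.r1]
  have hl := h.lam_pos
  have ht : 0 < w/r := by positivity
  have hLN : kL ≤ N := V.LR.trans V.RN
  have h0 := h.pos kL hLN
  have key := growth_up (fun i => a (kL+i) + 1) (w/r) ht.le (kR-kL)
    (by simp only [add_zero]; linarith) (by
    intro i hi
    have h1 := V.mid1 (kL+i+1) (by omega) (by omega)
    have h2 := (abs_le.1 (V.mid3 (kL+i+1) (by omega) (by omega))).1
    have h3 := h.step (kL+i)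
    have h4 := h.pos (kL+i) (by have := V.RN; omega)
    have h5 := mul_le_mul_of_nonneg_right h1 h4.le
    push_cast at *
    exact le_of_mul_le_mul_left (a := lam) (by rw [← add_assoc]; linarith) hl)
  intro k h1 h2
  have h3 := key (k-kL) (by omega)
  simp only [add_zero, Nat.add_sub_cancel' h1] at h3
  have h4 := win_exp hw V (kR-kL) le_rfl
  have h5 := win_upL H h V kL le_rfl
  have h6 : Real.exp (w/r * ((kR-kL:ℕ):ℝ)) * (a kL+1) ≤ Real.exp (w^2) * (2/θ+1) :=
    mul_le_mul h4 (by linarith) (by linarith) (by positivity)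
  linarith

lemma win_loM (H : CH c a₁ θ B κ) (hw : 0 < w) (hC : 0 < C₃) (h : SiteSol c N ρ lam a)
    (V : Win c θ W w C₃ N ρ lam r kL kR) :
    ∀ k, kL ≤ k → k ≤ kR → 1/C₃ ≤ Real.exp (w^2) * a k := by
  have hr : 0 < r := by linarith [V.r1]
  have hl := h.lam_pos
  have ht : 0 < w/r := by positivity
  have hLN : kL ≤ N := V.LR.trans V.RN
  have hRN := V.RN
  intro k h1 h2
  have hk := h.pos k (by omega)
  rcases le_total (k:ℝ) ρ with hc | hc
  · have key := growth_dn (fun i => a (kL+i)) (w/r) ht.le (k-kL)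
      (fun i hi => (h.pos _ (by omega)).le) (by
      intro i hi
      have h1 := V.mid2 (kL+i+1) (by omega) (by omega)
      have h3 := h.step (kL+i)
      have h4 := h.pos (kL+i) (by have := V.RN; omega)
      have h5 := mul_le_mul_of_nonneg_right h1 h4.le
      have h6 : kL + i + 1 ≤ k := by omega
      have h7 : ((kL + i + 1 : ℕ):ℝ) ≤ k := by exact_mod_cast h6
      push_cast at *
      have h8 : c (kL+i+1) * a (kL+i) ≤ lam * a (kL+i+1) := by linarith
      have h9 := mul_le_mul_of_nonneg_left h8 (by linarith : 0 ≤ 1 + w/r)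
      exact le_of_mul_le_mul_left (a := lam) (by rw [← add_assoc]; linarith) hl)
    have h3 := key (k-kL) le_rfl
    simp only [add_zero, Nat.add_sub_cancel' h1] at h3
    have h4 := win_exp hw V (k-kL) (by omega)
    have h5 := win_loL H hC h V kL le_rfl
    have h6 := mul_le_mul_of_nonneg_right h4 hk.le
    linarith
  · have key := growth_dn (fun i => a (kR-i)) (w/r) ht.le (kR-k)
      (fun i hi => (h.pos _ (by omega)).le) (by
      intro i hi
      obtain ⟨j, hj⟩ : ∃ j, kR - i = j+1 := ⟨kR-i-1, by omega⟩
      have hj' : kR - (i+1) = j := by omega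
      show a (kR-i) ≤ (1+w/r) * a (kR-(i+1))
      rw [hj, hj']
      have h1 := V.mid1 (j+1) (by omega) (by omega)
      have h3 := h.step j
      have h4 := h.pos j (by omega)
      have h5 := mul_le_mul_of_nonneg_right h1 h4.le
      have h6 : k ≤ j + 1 := by omega
      have h7 : (k:ℝ) ≤ ((j+1 : ℕ):ℝ) := by exact_mod_cast h6
      push_cast at *
      exact le_of_mul_le_mul_left (a := lam) (by linarith) hl)
    have h3 := key (kR-k) le_rfl
    simp only [Nat.sub_zero, Nat.sub_sub_self h2] at h3
    have h4 := win_exp hw V (kR-k) (by omega)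
    have h5 := win_loR H hC h V (N-kR) kR (by omega) (by omega)
    have h6 := mul_le_mul_of_nonneg_right h4 hk.le
    linarith

lemma win_bounds (H : CH c a₁ θ B κ) (hw : 0 < w) (hC : 0 < C₃) (h : SiteSol c N ρ lam a)
    (V : Win c θ W w C₃ N ρ lam r kL kR) :
    ∀ k ≤ N, 1/C₃/Real.exp (w^2) ≤ a k ∧ a k ≤ Real.exp (w^2) * (2/θ+1) := by
  have hθ := H.th_pos
  have he : 1 ≤ Real.exp (w^2) := Real.one_le_exp (by positivity)
  have e1 : 1/C₃/Real.exp (w^2) ≤ 1/C₃ := div_le_self (by positivity) he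
  have e2 : 2/θ ≤ Real.exp (w^2) * (2/θ+1) := by
    have : 0 < 2/θ := by positivity
    have := mul_le_mul_of_nonneg_right he (by linarith : 0 ≤ 2/θ+1)
    linarith
  intro k hk
  by_cases h1 : k ≤ kL
  · exact ⟨e1.trans (win_loL H hC h V k h1), (win_upL H h V k h1).trans e2⟩
  by_cases h2 : kR ≤ k
  · exact ⟨e1.trans (win_loR H hC h V (N-k) k (by omega) (by omega)),
      (win_upR H h V (N-k) k (by omega) (by omega)).trans e2⟩
  refine ⟨?_, win_upM H hw h V k (by omega) (by omega)⟩
  rw [div_le_iff₀ (by positivity), mul_comm]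
  exact win_loM H hw hC h V k (by omega) (by omega)

lemma win_d (H : CH c a₁ θ B κ) (hw : 0 < w) (hW : 0 < W) (h : SiteSol c N ρ lam a)
    (hN : 1 ≤ N)
    (V : Win c θ W w C₃ N ρ lam r kL kR) (S Q D₁ : ℝ) (hS : ∀ k ≤ N, a k ≤ S) (hS0 : 0 ≤ S)
    (hQ : Q = a₁*S+1) (hD : D₁ = Q*w + 2*Q/(θ*W)) :
    ∀ k < N, r * |a (k+1) - a k| ≤ Real.exp (w^2) * (D₁+Q) := by
  have hr : 0 < r := by linarith [V.r1]
  have hl := h.lam_pos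
  have hθ := H.th_pos
  have ha₁ := H.a1_pos
  have hRN := V.RN
  have hLR := win_LR hW V
  have ht : 0 < w/r := by positivity
  have hQ0 : 0 < Q := by rw [hQ]; positivity
  have hD0 : 0 < D₁ := by rw [hD]; positivity
  have hlip1 : ∀ k, |c (k+1) - c k| ≤ a₁ := by
    intro k; have := H.lip k 1; simpa using this
  have hrec : ∀ k, k + 2 ≤ N → |lam * (a (k+2) - a (k+1)) - c (k+1) * (a (k+1) - a k)| ≤ Q := by
    intro k hk
    have e : lam * (a (k+2) - a (k+1)) - c (k+1) * (a (k+1) - a k)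
        = (c (k+2) - c (k+1)) * a (k+1) - 1 := by
      have h1 := h.step (k+1)
      have h2 := h.step k
      push_cast at h1
      rw [show k+1+1 = k+2 by ring] at h1
      linarith
    rw [e]
    have h3 := abs_sub ((c (k+2) - c (k+1)) * a (k+1)) 1
    have h4 : |(c (k+2) - c (k+1)) * a (k+1)| ≤ a₁ * S := by
      rw [abs_mul, abs_of_pos (h.pos (k+1) (by omega))]
      exact mul_le_mul (hlip1 (k+1)) (hS _ (by omega)) (h.pos _ (by omega)).le ha₁.le
    rw [abs_one] at h3
    linarith
  have hup : ∀ k, k + 2 ≤ N → lam * (r*|a (k+1+1) - a (k+1)|) ≤ c (k+1) * (r*|a (k+1) - a k|) + Q*r := by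
    intro k hk
    have h1 := hrec k hk
    have h2 := abs_sub_abs_le_abs_sub (lam * (a (k+2) - a (k+1))) (c (k+1) * (a (k+1) - a k))
    rw [abs_mul, abs_mul, abs_of_pos hl, abs_of_pos (H.cpos k)] at h2
    have h3 := mul_le_mul_of_nonneg_left (h2.trans h1) hr.le
    rw [show k+1+1 = k+2 by ring]
    linarith
  have hdn : ∀ k, k + 2 ≤ N → c (k+1) * (r*|a (k+1) - a k|) ≤ lam * (r*|a (k+1+1) - a (k+1)|) + Q*r := by
    intro k hk
    have h1 := hrec k hk
    have h2 := abs_sub_abs_le_abs_sub (c (k+1) * (a (k+1) - a k)) (lam * (a (k+2) - a (k+1)))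
    rw [abs_sub_comm (c (k+1) * (a (k+1) - a k)), abs_mul, abs_mul, abs_of_pos hl,
      abs_of_pos (H.cpos k)] at h2
    have h3 := mul_le_mul_of_nonneg_left (h2.trans h1) hr.le
    rw [show k+1+1 = k+2 by ring]
    linarith
  have hQD : 2*Q ≤ D₁*(θ*W) := by
    have h1 : 2*Q/(θ*W)*(θ*W) = 2*Q := by field_simp
    have h2 : 0 ≤ Q*w*(θ*W) := by positivity
    rw [hD, add_mul]; linarith
  have hQr : ∀ x y, θ/2*y ≤ x → W*r ≤ y → Q*r ≤ D₁*x := by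
    intro x y h1 h2
    have h3 := mul_le_mul_of_nonneg_left h2 hθ.le
    have h4 := mul_le_mul_of_nonneg_left (by linarith : θ*(W*r) ≤ 2*x) hD0.le
    have h5 := mul_le_mul_of_nonneg_right hQD hr.le
    linarith
  have hleft : ∀ k ≤ kL, r*|a (k+1) - a k| ≤ D₁ := by
    intro k
    induction k with
    | zero =>
      intro _
      have h1 := h.step 0
      have h2 := h.zero
      have e : lam * (a 1 - a 0) = (c 1 - c 0) * a 0 - 1 := by
        rw [H.c0]; push_cast at h1; rw [zero_add] at h1; linarith
      have h3 := abs_sub ((c 1 - c 0) * a 0) 1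
      have h4 : |(c 1 - c 0) * a 0| ≤ a₁ * S := by
        rw [abs_mul, abs_of_pos (h.pos 0 (by omega))]
        exact mul_le_mul (hlip1 0) (hS _ (by omega)) (h.pos _ (by omega)).le ha₁.le
      rw [← e, abs_one, abs_mul, abs_of_pos hl] at h3
      have h5 : lam * |a 1 - a 0| ≤ Q := by linarith
      have h6 := mul_le_mul_of_nonneg_right V.rl (abs_nonneg (a 1 - a 0))
      have h7 := mul_le_mul_of_nonneg_left h5 ht.le
      have h8 : w/r ≤ w := div_le_self hw.le V.r1
      have h9 := mul_le_mul_of_nonneg_right h8 hQ0.le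
      have h10 : 0 < 2*Q/(θ*W) := by positivity
      rw [zero_add]
      linarith
    | succ k ih =>
      intro hk
      have h1 := ih (by omega)
      have h2 := hup k (by omega)
      have h3 := V.left (k+1) hk
      have h4 := hQr _ _ h3.1 h3.2.2
      have h5 := mul_le_mul_of_nonneg_left h1 (H.cpos k).le
      exact le_of_mul_le_mul_left (a := lam) (by linarith) hl
  have hright : ∀ i k, k + 1 + i = N → kR ≤ k + 1 → r*|a (k+1) - a k| ≤ D₁ := by
    intro i
    induction i with
    | zero =>
      intro k hk _
      have h1 := h.topeq
      rw [← hk] at h1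
      simp at h1
      rw [h1, sub_self, abs_zero, mul_zero]; exact hD0.le
    | succ i ih =>
      intro k hk hkR
      have h1 := ih (k+1) (by omega) (by omega)
      have h2 := hdn k (by omega)
      have h3 := V.right (k+1) hkR
      have h4 := hQr _ _ h3.1 h3.2.2
      have h5 := mul_le_mul_of_nonneg_left h1 hl.le
      exact le_of_mul_le_mul_left (a := c (k+1)) (by linarith) (H.cpos k)
  have key := growth_up (fun i => r*|a (kL+i+1) - a (kL+i)| + Q) (w/r) ht.le (kR-1-kL)
    (by positivity) (by
    intro i hi
    have h1 := V.mid1 (kL+i+1) (by omega) (by omega)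
    have h2 := hup (kL+i) (by omega)
    have h4 : 0 ≤ r*|a (kL+i+1) - a (kL+i)| := by positivity
    have h5 := mul_le_mul_of_nonneg_right h1 h4
    have h6 := mul_le_mul_of_nonneg_right V.rl hQ0.le
    simp only [← add_assoc]
    exact le_of_mul_le_mul_left (a := lam) (by linarith) hl)
  have he : 1 ≤ Real.exp (w^2) := Real.one_le_exp (by positivity)
  have e2 : D₁ ≤ Real.exp (w^2) * (D₁+Q) := by
    have := mul_le_mul_of_nonneg_right he (by linarith : 0 ≤ D₁+Q)
    linarith
  intro k hk
  by_cases h1 : k ≤ kL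
  · exact (hleft k h1).trans e2
  by_cases h2 : kR ≤ k+1
  · exact (hright (N-(k+1)) k (by omega) h2).trans e2
  have h3 := key (k-kL) (by omega)
  simp only [add_zero, Nat.add_sub_cancel' (by omega : kL ≤ k)] at h3
  have h4 := win_exp hw V (kR-1-kL) (by omega)
  have h5 := hleft kL le_rfl
  have h6 : Real.exp (w/r * ((kR-1-kL:ℕ):ℝ)) * (r*|a (kL+1) - a kL|+Q) ≤ Real.exp (w^2) * (D₁+Q) :=
    mul_le_mul h4 (by linarith) (by positivity) (by positivity)
  linarith
end

/-- The one-site lemma. -/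
lemma one_site {c : ℕ → ℝ} {a₁ θ B κ : ℝ} (H : CH c a₁ θ B κ) :
    ∃ m S C : ℝ, ∃ K : ℕ, 0 < m ∧ 0 < S ∧ 0 < C ∧ 1 ≤ K ∧ ∀ L N : ℕ, 2 ≤ L → K ≤ N →
      ∃ (lam : ℝ) (a : ℕ → ℝ), SiteSol c N ((N:ℝ)/L) lam a ∧ (∀ k ≤ N, m ≤ a k ∧ a k ≤ S) ∧
        ∀ k < N, |a (k+1) - a k| * N ≤ C * L * Real.sqrt N := by
  obtain ⟨r₀, W, w, C₃, hr₀, hW, hw, hC₃, hwin⟩ := exists_win H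
  obtain ⟨m₁, S₁, K, hm₁, hS₁, hsm⟩ := small_case H (r₀^2) (by positivity)
  have hθ := H.th_pos
  have ha₁ := H.a1_pos
  obtain ⟨m₂, hm₂⟩ : ∃ m, m = 1/C₃/Real.exp (w^2) := ⟨_, rfl⟩
  obtain ⟨S₂, hS₂⟩ : ∃ m, m = Real.exp (w^2) * (2/θ+1) := ⟨_, rfl⟩
  have hm20 : 0 < m₂ := by rw [hm₂]; positivity
  have hS20 : 0 < S₂ := by rw [hS₂]; positivity
  obtain ⟨Q, hQ⟩ : ∃ m, m = a₁*S₂+1 := ⟨_, rfl⟩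
  obtain ⟨D₁, hD₁⟩ : ∃ m, m = Q*w + 2*Q/(θ*W) := ⟨_, rfl⟩
  have hQ0 : 0 < Q := by rw [hQ]; positivity
  have hD0 : 0 < D₁ := by rw [hD₁]; positivity
  obtain ⟨D, hD⟩ : ∃ m, m = Real.exp (w^2) * (D₁+Q) := ⟨_, rfl⟩
  have hDD0 : 0 < D := by rw [hD]; positivity
  refine ⟨min m₁ m₂, max S₁ S₂, S₁*r₀^2 + D, max K 1, lt_min hm₁ hm20, lt_max_of_lt_left hS₁,
    by positivity, le_max_right _ _, ?_⟩
  intro L N hL hKN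
  have hN : 1 ≤ N := (le_max_right _ _).trans hKN
  have hK : K ≤ N := (le_max_left _ _).trans hKN
  have hN' : (1:ℝ) ≤ N := by exact_mod_cast hN
  have hL' : (2:ℝ) ≤ L := by exact_mod_cast hL
  have hL0 : (0:ℝ) < L := by linarith
  obtain ⟨ρ, hρ⟩ : ∃ ρ : ℝ, ρ = N/L := ⟨_, rfl⟩
  rw [← hρ]
  have hρ0 : 0 < ρ := by rw [hρ]; positivity
  have hρL : ρ * L = N := by rw [hρ]; field_simp
  have hρ2 : 2*ρ ≤ N := by rw [← hρL, mul_comm]; exact mul_le_mul_of_nonneg_left hL' hρ0.le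
  have hcpos : ∀ n : ℕ, 0 < n → 0 < c n := fun n hn => H.kap_pos.trans_le (H.cmin n hn)
  obtain ⟨lam, a, h⟩ := exists_sol c hcpos N ρ hN hρ0 (by linarith)
  refine ⟨lam, a, h, ?_⟩
  have hsN : 1 ≤ Real.sqrt N := Real.one_le_sqrt.2 hN'
  rcases le_total ρ (r₀^2) with hc | hc
  · have hb := hsm N ρ lam a hK hN hρ0 hc hρ2 h
    refine ⟨fun k hk => ⟨(min_le_left _ _).trans (hb k hk).1, (hb k hk).2.trans (le_max_left _ _)⟩, ?_⟩
    intro k hk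
    have h1 := hb k (by omega)
    have h2 := hb (k+1) (by omega)
    have h3 : |a (k+1) - a k| ≤ S₁ := abs_le.2 ⟨by linarith, by linarith⟩
    have h4 : (N:ℝ) ≤ r₀^2 * L := by rw [← hρL]; exact mul_le_mul_of_nonneg_right hc hL0.le
    have h5 : |a (k+1) - a k| * N ≤ S₁ * (r₀^2 * L) := mul_le_mul h3 h4 (by linarith) hS₁.le
    have h6 : S₁ * (r₀^2 * L) * 1 ≤ S₁ * (r₀^2 * L) * Real.sqrt N :=
      mul_le_mul_of_nonneg_left hsN (by positivity)
    have h7 : 0 ≤ D * L * Real.sqrt N := by positivity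
    linarith
  · have hr : r₀ ≤ Real.sqrt ρ := Real.le_sqrt_of_sq_le hc
    have hr0 : 0 < Real.sqrt ρ := by linarith
    obtain ⟨kL, kR, V⟩ := hwin N ρ lam (Real.sqrt ρ) a hN hρ2 hr (Real.sq_sqrt hρ0.le).symm h
    have hb := win_bounds H hw hC₃ h V
    rw [← hm₂, ← hS₂] at hb
    refine ⟨fun k hk => ⟨(min_le_right _ _).trans (hb k hk).1, (hb k hk).2.trans (le_max_right _ _)⟩, ?_⟩
    intro k hk
    have h1 := win_d H hw hW h hN V S₂ Q D₁ (fun k hk => (hb k hk).2) hS20.le hQ hD₁ k hk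
    rw [← hD] at h1
    have e1 : Real.sqrt ρ * Real.sqrt ρ = ρ := Real.mul_self_sqrt hρ0.le
    have e2 : Real.sqrt N = Real.sqrt ρ * Real.sqrt L := by
      rw [← hρL, Real.sqrt_mul hρ0.le]
    have e3 : Real.sqrt L * Real.sqrt L = L := Real.mul_self_sqrt hL0.le
    have e4 : 1 ≤ Real.sqrt L := Real.one_le_sqrt.2 (by linarith)
    have h2 : |a (k+1) - a k| * N = (Real.sqrt ρ * |a (k+1) - a k|) * (Real.sqrt ρ * L) := by
      have e : (Real.sqrt ρ * |a (k+1) - a k|) * (Real.sqrt ρ * L)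
          = |a (k+1) - a k| * ((Real.sqrt ρ * Real.sqrt ρ) * L) := by ring
      rw [e, e1, hρL]
    rw [h2, e2]
    calc (Real.sqrt ρ * |a (k+1) - a k|) * (Real.sqrt ρ * L) ≤ D * (Real.sqrt ρ * L) :=
          mul_le_mul_of_nonneg_right h1 (by positivity)
      _ ≤ D * (Real.sqrt ρ * L) * Real.sqrt L := le_mul_of_one_le_right (by positivity) e4
      _ = D * L * (Real.sqrt ρ * Real.sqrt L) := by ring
      _ ≤ (S₁*r₀^2+D) * L * (Real.sqrt ρ * Real.sqrt L) := by
          have : 0 ≤ S₁*r₀^2 := by positivity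
          gcongr; linarith


/-- product weight -/
noncomputable def Wt (c : ℕ → ℝ) (Λ : Finset ℤ) (η : ℤ → ℕ) : ℝ := ∏ x ∈ Λ, (cfact c (η x))⁻¹

/-- add one particle at `x` -/
def up (ξ : ℤ → ℕ) (x : ℤ) : ℤ → ℕ := Function.update ξ x (ξ x + 1)

/-- unnormalized expectation -/
noncomputable def EV (c : ℕ → ℝ) (Λ : Finset ℤ) (N : ℕ) (F : (ℤ → ℕ) → ℝ) : ℝ :=
  ∑ η ∈ Finset.piAntidiag Λ N, Wt c Λ η * F η

lemma mem_conf {Λ : Finset ℤ} {N : ℕ} {η : ℤ → ℕ} : η ∈ Finset.piAntidiag Λ N ↔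
    (∀ x, x ∉ Λ → η x = 0) ∧ (∑ x ∈ Λ, η x) = N := by
  rw [Finset.mem_piAntidiag, and_comm]
  refine and_congr_left fun _ => forall_congr' fun x => ?_
  constructor
  · intro h hx; by_contra h0; exact hx (h h0)
  · intro h hx; by_contra h0; exact hx (h h0)

lemma conf_le {Λ : Finset ℤ} {N : ℕ} {η : ℤ → ℕ} (h : η ∈ Finset.piAntidiag Λ N) {x : ℤ}
    (hx : x ∈ Λ) : η x ≤ N := by
  rw [← (mem_conf.1 h).2]
  exact Finset.single_le_sum (f := η) (fun _ _ => Nat.zero_le _) hx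

lemma tsum_conf (c : ℕ → ℝ) (Λ : Finset ℤ) (N : ℕ) (F : (ℤ → ℕ) → ℝ) :
    ∑' η : ℤ → ℕ, nuW c Λ N η * F η = EV c Λ N F := by
  rw [tsum_eq_sum (s := Finset.piAntidiag Λ N)]
  · refine Finset.sum_congr rfl fun η hη => ?_
    have h : η ∈ {η : ℤ → ℕ | (∀ x, x ∉ Λ → η x = 0) ∧ (∑ x ∈ Λ, η x) = N} := mem_conf.1 hη
    rw [nuW, Set.indicator_of_mem h]; rfl
  · intro η hη
    have h : η ∉ {η : ℤ → ℕ | (∀ x, x ∉ Λ → η x = 0) ∧ (∑ x ∈ Λ, η x) = N} :=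
      fun h => hη (mem_conf.2 h)
    rw [nuW, Set.indicator_of_notMem h, zero_mul]

lemma wE_eq (c : ℕ → ℝ) (Λ : Finset ℤ) (N : ℕ) (F : (ℤ → ℕ) → ℝ) :
    wE (nuW c Λ N) F = EV c Λ N F / EV c Λ N (fun _ => 1) := by
  have h := tsum_conf c Λ N (fun _ => 1)
  simp only [mul_one] at h
  rw [wE, tsum_conf, h]

lemma cfact_pos {c : ℕ → ℝ} (hc : ∀ k, 0 < c (k+1)) (k : ℕ) : 0 < cfact c k := by
  induction k with
  | zero => exact one_pos
  | succ n ih => exact mul_pos ih (hc n)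

lemma Wt_pos {c : ℕ → ℝ} (hc : ∀ k, 0 < c (k+1)) (Λ : Finset ℤ) (η : ℤ → ℕ) : 0 < Wt c Λ η :=
  Finset.prod_pos fun _ _ => inv_pos.2 (cfact_pos hc _)

lemma up_same (ξ : ℤ → ℕ) (x : ℤ) : up ξ x x = ξ x + 1 := by simp [up]
lemma up_ne (ξ : ℤ → ℕ) {x y : ℤ} (h : y ≠ x) : up ξ x y = ξ y := by simp [up, h]

lemma sum_up (Λ : Finset ℤ) {x : ℤ} (hx : x ∈ Λ) (ξ : ℤ → ℕ) (F : ℕ → ℝ) :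
    ∑ y ∈ Λ, F (up ξ x y) = ∑ y ∈ Λ, F (ξ y) + (F (ξ x + 1) - F (ξ x)) := by
  rw [← Finset.add_sum_erase _ _ hx, ← Finset.add_sum_erase Λ (fun y => F (ξ y)) hx, up_same]
  have : ∑ y ∈ Λ.erase x, F (up ξ x y) = ∑ y ∈ Λ.erase x, F (ξ y) :=
    Finset.sum_congr rfl fun y hy => by rw [up_ne _ (Finset.ne_of_mem_erase hy)]
  rw [this]; ring

lemma sum_up_nat (Λ : Finset ℤ) {x : ℤ} (hx : x ∈ Λ) (ξ : ℤ → ℕ) :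
    ∑ y ∈ Λ, up ξ x y = ∑ y ∈ Λ, ξ y + 1 := by
  have := sum_up Λ hx ξ (fun k => (k:ℝ))
  push_cast at this
  have h2 : ((∑ y ∈ Λ, up ξ x y : ℕ):ℝ) = ((∑ y ∈ Λ, ξ y + 1 : ℕ) : ℝ) := by
    push_cast; linarith
  exact_mod_cast h2

lemma up_mem {Λ : Finset ℤ} {M : ℕ} {ξ : ℤ → ℕ} (h : ξ ∈ Finset.piAntidiag Λ M) {x : ℤ}
    (hx : x ∈ Λ) : up ξ x ∈ Finset.piAntidiag Λ (M+1) := by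
  rw [mem_conf] at *
  refine ⟨fun y hy => ?_, by rw [sum_up_nat Λ hx, h.2]⟩
  have hne : y ≠ x := by rintro rfl; exact hy hx
  rw [up_ne _ hne]; exact h.1 y hy

lemma Wt_up {c : ℕ → ℝ} (hc : ∀ k, 0 < c (k+1)) (Λ : Finset ℤ) {x : ℤ} (hx : x ∈ Λ)
    (ξ : ℤ → ℕ) : Wt c Λ (up ξ x) * c (ξ x + 1) = Wt c Λ ξ := by
  unfold Wt
  rw [← Finset.mul_prod_erase _ _ hx, ← Finset.mul_prod_erase Λ (fun y => (cfact c (ξ y))⁻¹) hx,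
    up_same]
  have : ∏ y ∈ Λ.erase x, (cfact c (up ξ x y))⁻¹ = ∏ y ∈ Λ.erase x, (cfact c (ξ y))⁻¹ :=
    Finset.prod_congr rfl fun y hy => by rw [up_ne _ (Finset.ne_of_mem_erase hy)]
  rw [this]
  have h1 := (cfact_pos hc (ξ x)).ne'
  have h2 := (hc (ξ x)).ne'
  show (cfact c (ξ x) * c (ξ x + 1))⁻¹ * _ * _ = _
  field_simp

lemma shift {c : ℕ → ℝ} (hc0 : c 0 = 0) (hc : ∀ k, 0 < c (k+1)) (Λ : Finset ℤ) (M : ℕ) {x : ℤ}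
    (hx : x ∈ Λ) (F : (ℤ → ℕ) → ℝ) :
    ∑ ξ ∈ Finset.piAntidiag Λ M, Wt c Λ ξ * F (up ξ x)
      = ∑ η ∈ Finset.piAntidiag Λ (M+1), Wt c Λ η * (c (η x) * F η) := by
  refine Finset.sum_of_injOn (fun ξ => up ξ x) ?_ ?_ ?_ ?_
  · intro ξ _ ξ' _ h
    funext y
    have h1 := congrFun h y
    by_cases hy : y = x
    · subst hy; simp only [up_same] at h1; omega
    · simpa only [up_ne _ hy] using h1
  · intro ξ h; exact up_mem h hx
  · intro η hη hn
    by_cases h0 : η x = 0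
    · rw [h0, hc0]; ring
    · exfalso
      apply hn
      refine ⟨Function.update η x (η x - 1), ?_, ?_⟩
      · have e : up (Function.update η x (η x - 1)) x = η := by
          funext y
          by_cases hy : y = x
          · subst hy; rw [up_same]; simp; omega
          · rw [up_ne _ hy]; simp [hy]
        have h2 := mem_conf.1 hη
        simp only [Finset.mem_coe]
        rw [mem_conf]
        refine ⟨fun y hy => ?_, ?_⟩
        · have : y ≠ x := by rintro rfl; exact hy hx
          simp [this, h2.1 y hy]
        · have := sum_up_nat Λ hx (Function.update η x (η x - 1))
          rw [e, h2.2] at this; omega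
      · funext y
        by_cases hy : y = x
        · subst hy; simp only [up_same]; simp; omega
        · simp only [up_ne _ hy]; simp [hy]
  · intro ξ _
    show _ = Wt c Λ (up ξ x) * (c (up ξ x x) * F (up ξ x))
    rw [up_same, ← mul_assoc, Wt_up hc Λ hx]

lemma move_up (ξ : ℤ → ℕ) {x y : ℤ} (h : x ≠ y) : move (up ξ x) x y = up ξ y := by
  funext z
  unfold move
  by_cases h1 : z = x
  · subst h1; rw [if_pos rfl, up_same, up_ne _ h]; omega
  · rw [if_neg h1]
    by_cases h2 : z = y
    · subst h2; rw [if_pos rfl, up_same, up_ne _ h1]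
    · rw [if_neg h2, up_ne _ h1, up_ne _ h2]

/-- moving particle -/
lemma moving (u : ℤ → ℝ) (b : ℤ) (L : ℕ) {x y : ℤ} (hx : x ∈ Finset.Ico b (b+L))
    (hy : y ∈ Finset.Ico b (b+L)) :
    (u x - u y)^2 ≤ L * ∑ p ∈ Finset.Ico b (b+L), ∑ q ∈ Finset.Ico b (b+L),
      if |p - q| = 1 then (u q - u p)^2 else 0 := by
  wlog hxy : x ≤ y generalizing x y
  · have := this hy hx (by omega)
    rwa [← neg_sub, neg_sq]
  obtain ⟨n, rfl⟩ := Int.le.dest hxy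
  rw [Finset.mem_Ico] at hx hy
  set Λ := Finset.Ico b (b+L) with hΛ
  set F : ℤ → ℝ := fun p => ∑ q ∈ Λ, if |p - q| = 1 then (u q - u p)^2 else 0 with hF
  have hF0 : ∀ p, 0 ≤ F p := fun p => Finset.sum_nonneg fun q _ => by split_ifs <;> positivity
  have h1 : u (x+n) - u x = ∑ i ∈ Finset.range n, (u (x+i+1) - u (x+i)) := by
    have := Finset.sum_range_sub (fun i : ℕ => u (x+i)) n
    push_cast at this
    rw [add_zero] at this
    rw [← this]
    exact Finset.sum_congr rfl fun i _ => by rw [add_assoc]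
  have h2 : (u (x+n) - u x)^2 ≤ n * ∑ i ∈ Finset.range n, (u (x+i+1) - u (x+i))^2 := by
    rw [h1]
    have := sq_sum_le_card_mul_sum_sq (s := Finset.range n) (f := fun i : ℕ => u (x+i+1) - u (x+i))
    simpa using this
  have h3 : ∑ i ∈ Finset.range n, (u (x+i+1) - u (x+i))^2 ≤ ∑ p ∈ Λ, F p := by
    calc ∑ i ∈ Finset.range n, (u (x+i+1) - u (x+i))^2
        ≤ ∑ i ∈ Finset.range n, F (x+i) := by
          refine Finset.sum_le_sum fun i hi => ?_
          rw [Finset.mem_range] at hi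
          have hq : x + i + 1 ∈ Λ := by rw [hΛ, Finset.mem_Ico]; omega
          have := Finset.single_le_sum (f := fun q => if |(x+i) - q| = 1 then (u q - u (x+i))^2 else 0)
            (fun q _ => by split_ifs <;> positivity) hq
          simpa using this
      _ = ∑ p ∈ (Finset.range n).image (fun i : ℕ => x + i), F p := by
          rw [Finset.sum_image]
          intro i _ j _ h; simpa using h
      _ ≤ ∑ p ∈ Λ, F p := by
          refine Finset.sum_le_sum_of_subset_of_nonneg ?_ (fun p _ _ => hF0 p)
          intro p hp
          rw [Finset.mem_image] at hp
          obtain ⟨i, hi, rfl⟩ := hp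
          rw [Finset.mem_range] at hi
          rw [hΛ, Finset.mem_Ico]; omega
  have h4 : (n:ℝ) ≤ L := by
    have : n ≤ L := by omega
    exact_mod_cast this
  rw [← neg_sub, neg_sq]
  exact h2.trans (mul_le_mul h4 h3 (Finset.sum_nonneg fun _ _ => by positivity) (by positivity))

lemma EV_nonneg {c : ℕ → ℝ} (hc : ∀ k, 0 < c (k+1)) (Λ : Finset ℤ) (N : ℕ) (F : (ℤ → ℕ) → ℝ)
    (hF : ∀ η, 0 ≤ F η) : 0 ≤ EV c Λ N F :=
  Finset.sum_nonneg fun η _ => mul_nonneg (Wt_pos hc Λ η).le (hF η)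

lemma EV_mono {c : ℕ → ℝ} (hc : ∀ k, 0 < c (k+1)) (Λ : Finset ℤ) (N : ℕ) (F F' : (ℤ → ℕ) → ℝ)
    (hF : ∀ η ∈ Finset.piAntidiag Λ N, F η ≤ F' η) : EV c Λ N F ≤ EV c Λ N F' :=
  Finset.sum_le_sum fun η h => mul_le_mul_of_nonneg_left (hF η h) (Wt_pos hc Λ η).le

lemma EV_smul (c : ℕ → ℝ) (Λ : Finset ℤ) (N : ℕ) (t : ℝ) (F : (ℤ → ℕ) → ℝ) :
    EV c Λ N (fun η => t * F η) = t * EV c Λ N F := by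
  unfold EV; rw [Finset.mul_sum]; exact Finset.sum_congr rfl fun _ _ => by ring

lemma EV_add (c : ℕ → ℝ) (Λ : Finset ℤ) (N : ℕ) (F F' : (ℤ → ℕ) → ℝ) :
    EV c Λ N (fun η => F η + F' η) = EV c Λ N F + EV c Λ N F' := by
  unfold EV; rw [← Finset.sum_add_distrib]; exact Finset.sum_congr rfl fun _ _ => by ring

lemma EV_sub (c : ℕ → ℝ) (Λ : Finset ℤ) (N : ℕ) (F F' : (ℤ → ℕ) → ℝ) :
    EV c Λ N (fun η => F η - F' η) = EV c Λ N F - EV c Λ N F' := by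
  unfold EV; rw [← Finset.sum_sub_distrib]; exact Finset.sum_congr rfl fun _ _ => by ring

lemma EV_congr (c : ℕ → ℝ) (Λ : Finset ℤ) (N : ℕ) (F F' : (ℤ → ℕ) → ℝ)
    (h : ∀ η ∈ Finset.piAntidiag Λ N, F η = F' η) : EV c Λ N F = EV c Λ N F' :=
  Finset.sum_congr rfl fun η hη => by rw [h η hη]

lemma EV_abs {c : ℕ → ℝ} (hc : ∀ k, 0 < c (k+1)) (Λ : Finset ℤ) (N : ℕ) (F : (ℤ → ℕ) → ℝ) :
    |EV c Λ N F| ≤ EV c Λ N (fun η => |F η|) := by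
  unfold EV
  refine (Finset.abs_sum_le_sum_abs _ _).trans (Finset.sum_le_sum fun η _ => ?_)
  rw [abs_mul, abs_of_pos (Wt_pos hc Λ η)]

/-- entropy is nonnegative -/
lemma ent_nonneg {c : ℕ → ℝ} (hc : ∀ k, 0 < c (k+1)) (Λ : Finset ℤ) (N : ℕ) (f : (ℤ → ℕ) → ℝ)
    (hf : ∀ η, 0 ≤ f η) (hZ : 0 < EV c Λ N (fun _ => 1)) : 0 ≤ wEnt (nuW c Λ N) f := by
  unfold wEnt
  rw [wE_eq, wE_eq]
  set Z := EV c Λ N (fun _ => 1)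
  obtain ⟨v, hv⟩ : ∃ v, v = EV c Λ N f / Z := ⟨_, rfl⟩
  rw [← hv]
  have hvZ : v * Z = EV c Λ N f := by rw [hv]; field_simp
  have hv0 : 0 ≤ v := by rw [hv]; exact div_nonneg (EV_nonneg hc Λ N f hf) hZ.le
  rcases hv0.eq_or_lt with h0 | h0
  · rw [← h0] at hvZ ⊢
    rw [zero_mul] at hvZ
    have h1 : ∀ η ∈ Finset.piAntidiag Λ N, Wt c Λ η * f η = 0 :=
      (Finset.sum_eq_zero_iff_of_nonneg
        (fun η _ => mul_nonneg (Wt_pos hc Λ η).le (hf η))).1 hvZ.symm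
    have h2 : EV c Λ N (fun η => f η * Real.log (f η)) = 0 := by
      refine Finset.sum_eq_zero fun η hη => ?_
      rw [← mul_assoc, h1 η hη, zero_mul]
    rw [h2]; simp
  · have h1 : EV c Λ N (fun η => f η - v * 1) ≤
        EV c Λ N (fun η => f η * Real.log (f η) - Real.log v * f η) := by
      refine EV_mono hc Λ N _ _ fun η _ => ?_
      rcases (hf η).eq_or_lt with h | h
      · rw [← h]; simp; exact h0.le
      · have h2 := Real.log_le_sub_one_of_pos (div_pos h0 h)
        rw [Real.log_div h0.ne' h.ne'] at h2
        have h3 := mul_le_mul_of_nonneg_left h2 h.le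
        have h4 : f η * (v / f η - 1) = v - f η := by field_simp
        linarith
    rw [EV_sub, EV_smul, EV_sub, EV_smul, ← hvZ] at h1
    change _ - v * Z ≤ _ at h1
    rw [sub_nonneg, le_div_iff₀ hZ]
    linarith


section
variable {c : ℕ → ℝ} {Λ : Finset ℤ} {M : ℕ}

lemma shift_sum (hc0 : c 0 = 0) (hc : ∀ k, 0 < c (k+1)) (F : ℤ → (ℤ → ℕ) → ℝ) :
    ∑ ξ ∈ Finset.piAntidiag Λ M, Wt c Λ ξ * ∑ x ∈ Λ, F x (up ξ x)
      = EV c Λ (M+1) (fun η => ∑ x ∈ Λ, c (η x) * F x η) := by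
  unfold EV
  simp only [Finset.mul_sum]
  rw [Finset.sum_comm, Finset.sum_comm (s := Finset.piAntidiag Λ (M+1))]
  exact Finset.sum_congr rfl fun x hx => shift hc0 hc Λ M hx (F x)

lemma G_le {a₁ : ℝ} (hle : ∀ k : ℕ, c k ≤ a₁ * k) {N : ℕ} {η : ℤ → ℕ}
    (h : η ∈ Finset.piAntidiag Λ N) : ∑ x ∈ Λ, c (η x) ≤ a₁ * N := by
  calc ∑ x ∈ Λ, c (η x) ≤ ∑ x ∈ Λ, a₁ * (η x : ℝ) := Finset.sum_le_sum fun x _ => hle _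
    _ = a₁ * N := by rw [← Finset.mul_sum, ← (mem_conf.1 h).2]; push_cast; rfl

lemma T_identity (hc0 : c 0 = 0) (hc : ∀ k, 0 < c (k+1)) (L : ℕ) (hL : Λ.card = L) (hL0 : 0 < L)
    (lam : ℝ) (a : ℕ → ℝ)
    (hst : ∀ k : ℕ, c k * a (k-1) = lam * a k + k - ((M+1:ℕ):ℝ)/L)
    (f φ : (ℤ → ℕ) → ℝ)
    (hφ : ∀ η ∈ Finset.piAntidiag Λ (M+1), φ η * ∑ y ∈ Λ, a (η y) = f η * L) :
    ∑ ξ ∈ Finset.piAntidiag Λ M, Wt c Λ ξ * ∑ x ∈ Λ, ∑ y ∈ Λ, φ (up ξ x) * (a (ξ y) - a (ξ x))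
      = L * EV c Λ (M+1) (fun η => f η * (∑ x ∈ Λ, c (η x) - L * lam))
        - EV c Λ (M+1) (fun η => φ η * ∑ x ∈ Λ, c (η x) * (a (η x) - a (η x - 1))) := by
  have h1 := shift_sum (Λ := Λ) (M := M) hc0 hc
    (fun x η => φ η * (∑ y ∈ Λ, a (η y) - (a (η x) - a (η x - 1)) - L * a (η x - 1)))
  have h2 : ∑ ξ ∈ Finset.piAntidiag Λ M, Wt c Λ ξ * ∑ x ∈ Λ, ∑ y ∈ Λ, φ (up ξ x) * (a (ξ y) - a (ξ x))
      = ∑ ξ ∈ Finset.piAntidiag Λ M, Wt c Λ ξ * ∑ x ∈ Λ, φ (up ξ x) *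
        (∑ y ∈ Λ, a (up ξ x y) - (a (up ξ x x) - a (up ξ x x - 1)) - L * a (up ξ x x - 1)) := by
    refine Finset.sum_congr rfl fun ξ _ => ?_
    congr 1
    refine Finset.sum_congr rfl fun x hx => ?_
    rw [← Finset.mul_sum, sum_up Λ hx ξ a, up_same, Finset.sum_sub_distrib, Finset.sum_const, hL,
      Nat.add_sub_cancel, nsmul_eq_mul]
    ring
  rw [h2, h1, ← EV_smul, ← EV_sub]
  refine EV_congr c Λ _ _ _ fun η hη => ?_
  have h3 : ∑ x ∈ Λ, c (η x) * a (η x - 1) = lam * ∑ y ∈ Λ, a (η y) := by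
    have hLr : (L:ℝ) ≠ 0 := by positivity
    have : ∑ x ∈ Λ, (η x : ℝ) = ((M+1:ℕ):ℝ) := by rw [← (mem_conf.1 hη).2]; push_cast; rfl
    simp only [hst]
    rw [Finset.sum_sub_distrib, Finset.sum_add_distrib, ← Finset.mul_sum, this, Finset.sum_const, hL,
      nsmul_eq_mul]
    field_simp
    ring
  have h4 := hφ η hη
  have e : ∑ x ∈ Λ, c (η x) * (φ η * (∑ y ∈ Λ, a (η y) - (a (η x) - a (η x - 1)) - L * a (η x - 1)))
      = φ η * ((∑ y ∈ Λ, a (η y)) * (∑ x ∈ Λ, c (η x)) - (∑ x ∈ Λ, c (η x) * (a (η x) - a (η x - 1)))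
        - L * ∑ x ∈ Λ, c (η x) * a (η x - 1)) := by
    rw [Finset.mul_sum (a := ∑ y ∈ Λ, a (η y)), Finset.mul_sum (a := (L:ℝ)), ← Finset.sum_sub_distrib,
      ← Finset.sum_sub_distrib, Finset.mul_sum]
    exact Finset.sum_congr rfl fun x _ => by ring
  rw [e, h3]
  have e2 : ∀ A G X : ℝ, φ η * A = f η * L →
      φ η * (A * G - X - L * (lam * A)) = L * (f η * (G - L * lam)) - φ η * X := by
    intro A G X h
    have : φ η * (A * G - X - L * (lam * A)) = (φ η * A) * (G - L*lam) - φ η * X := by ring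
    rw [this, h]; ring
  exact e2 _ _ _ h4

lemma T_bound (hc : ∀ k, 0 < c (k+1)) (a : ℕ → ℝ) (S : ℝ)
    (ha : ∀ k ≤ M+1, 0 ≤ a k ∧ a k ≤ S) (φ : (ℤ → ℕ) → ℝ) :
    |∑ ξ ∈ Finset.piAntidiag Λ M, Wt c Λ ξ * ∑ x ∈ Λ, ∑ y ∈ Λ, φ (up ξ x) * (a (ξ y) - a (ξ x))|
      ≤ S/2 * ∑ ξ ∈ Finset.piAntidiag Λ M, Wt c Λ ξ *
        ∑ x ∈ Λ, ∑ y ∈ Λ, |φ (up ξ x) - φ (up ξ y)| := by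
  rw [Finset.mul_sum]
  refine (Finset.abs_sum_le_sum_abs _ _).trans (Finset.sum_le_sum fun ξ hξ => ?_)
  rw [abs_mul, abs_of_pos (Wt_pos hc Λ ξ), mul_left_comm]
  refine mul_le_mul_of_nonneg_left ?_ (Wt_pos hc Λ ξ).le
  have h1 : ∑ x ∈ Λ, ∑ y ∈ Λ, φ (up ξ x) * (a (ξ y) - a (ξ x))
      = (1/2) * ∑ x ∈ Λ, ∑ y ∈ Λ, (φ (up ξ x) - φ (up ξ y)) * (a (ξ y) - a (ξ x)) := by
    have h2 : ∑ x ∈ Λ, ∑ y ∈ Λ, (φ (up ξ x) - φ (up ξ y)) * (a (ξ y) - a (ξ x))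
        = ∑ x ∈ Λ, ∑ y ∈ Λ, φ (up ξ x) * (a (ξ y) - a (ξ x))
          + ∑ x ∈ Λ, ∑ y ∈ Λ, φ (up ξ y) * (a (ξ x) - a (ξ y)) := by
      rw [← Finset.sum_add_distrib]
      refine Finset.sum_congr rfl fun x _ => ?_
      rw [← Finset.sum_add_distrib]
      exact Finset.sum_congr rfl fun y _ => by ring
    rw [h2, Finset.sum_comm (f := fun x y => φ (up ξ y) * (a (ξ x) - a (ξ y)))]
    ring
  rw [h1, abs_mul, abs_of_pos (by norm_num : (0:ℝ) < 1/2)]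
  have h3 : |∑ x ∈ Λ, ∑ y ∈ Λ, (φ (up ξ x) - φ (up ξ y)) * (a (ξ y) - a (ξ x))|
      ≤ ∑ x ∈ Λ, ∑ y ∈ Λ, S * |φ (up ξ x) - φ (up ξ y)| := by
    refine (Finset.abs_sum_le_sum_abs _ _).trans (Finset.sum_le_sum fun x hx => ?_)
    refine (Finset.abs_sum_le_sum_abs _ _).trans (Finset.sum_le_sum fun y hy => ?_)
    rw [abs_mul, mul_comm]
    refine mul_le_mul_of_nonneg_right ?_ (abs_nonneg _)
    have h4 := ha (ξ x) ((conf_le hξ hx).trans (by omega))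
    have h5 := ha (ξ y) ((conf_le hξ hy).trans (by omega))
    exact abs_le.2 ⟨by linarith, by linarith⟩
  simp only [← Finset.mul_sum] at h3
  linarith

/-- sums over pairs of `H (up ξ x)` -/
lemma pair_sum (hc0 : c 0 = 0) (hc : ∀ k, 0 < c (k+1)) {a₁ : ℝ} (hle : ∀ k : ℕ, c k ≤ a₁ * k)
    (L : ℕ) (hL : Λ.card = L) (f : (ℤ → ℕ) → ℝ) (hf : ∀ η, 0 ≤ f η) :
    ∑ ξ ∈ Finset.piAntidiag Λ M, Wt c Λ ξ * ∑ x ∈ Λ, ∑ _y ∈ Λ, f (up ξ x)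
      ≤ L * (a₁ * (M+1:ℕ) * EV c Λ (M+1) f) := by
  have h1 := shift_sum (Λ := Λ) (M := M) hc0 hc (fun _ η => f η)
  have h2 : ∑ ξ ∈ Finset.piAntidiag Λ M, Wt c Λ ξ * ∑ x ∈ Λ, ∑ _y ∈ Λ, f (up ξ x)
      = L * ∑ ξ ∈ Finset.piAntidiag Λ M, Wt c Λ ξ * ∑ x ∈ Λ, f (up ξ x) := by
    rw [Finset.mul_sum]
    refine Finset.sum_congr rfl fun ξ _ => ?_
    simp only [Finset.sum_const, hL, nsmul_eq_mul]
    rw [← Finset.mul_sum]; ring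
  rw [h2, h1, ← EV_smul c Λ (M+1) (a₁ * (M+1:ℕ)) f]
  refine mul_le_mul_of_nonneg_left (EV_mono hc Λ _ _ _ fun η hη => ?_) (Nat.cast_nonneg L)
  rw [← Finset.sum_mul]
  exact mul_le_mul_of_nonneg_right (G_le hle hη) (hf η)

lemma phi_diff (m δ L A A' f f' : ℝ) (hm : 0 < m) (hL : 0 < L) (hA : m*L ≤ A) (hA' : m*L ≤ A')
    (hd : |A - A'| ≤ δ) (hf' : 0 ≤ f') :
    |f*L/A - f'*L/A'| ≤ |f - f'|/m + f'*(δ/(m^2*L)) := by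
  have hmL : 0 < m*L := by positivity
  have hA0 : 0 < A := by linarith
  have hA0' : 0 < A' := by linarith
  have e : f*L/A - f'*L/A' = (f-f')*(L/A) + f'*(L*(A'-A)/(A*A')) := by field_simp; ring
  rw [e]
  refine (abs_add_le _ _).trans (add_le_add ?_ ?_)
  · rw [abs_mul, abs_of_pos (by positivity : 0 < L/A), div_eq_mul_one_div |f-f'|]
    refine mul_le_mul_of_nonneg_left ?_ (abs_nonneg _)
    rw [div_le_div_iff₀ hA0 hm]; linarith
  · rw [abs_mul, abs_of_nonneg hf']
    refine mul_le_mul_of_nonneg_left ?_ hf'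
    rw [abs_div, abs_of_pos (by positivity : 0 < A*A'), abs_mul, abs_of_pos hL, abs_sub_comm]
    have h1 : (m*L)*(m*L) ≤ A*A' := mul_le_mul hA hA' hmL.le hA0.le
    have hδ : 0 ≤ δ := (abs_nonneg _).trans hd
    calc L*|A-A'|/(A*A') ≤ L*δ/((m*L)*(m*L)) := by gcongr
      _ = δ/(m^2*L) := by field_simp

lemma CS (hc0 : c 0 = 0) (hc : ∀ k, 0 < c (k+1)) {a₁ : ℝ} (hle : ∀ k : ℕ, c k ≤ a₁ * k)
    (L : ℕ) (hL : Λ.card = L) (f : (ℤ → ℕ) → ℝ) (hf : ∀ η, 0 ≤ f η) :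
    (∑ ξ ∈ Finset.piAntidiag Λ M, Wt c Λ ξ * ∑ x ∈ Λ, ∑ y ∈ Λ, |f (up ξ x) - f (up ξ y)|)^2
      ≤ (∑ ξ ∈ Finset.piAntidiag Λ M, Wt c Λ ξ * ∑ x ∈ Λ, ∑ y ∈ Λ,
          (Real.sqrt (f (up ξ x)) - Real.sqrt (f (up ξ y)))^2) *
        (4 * (L * (a₁ * (M+1:ℕ) * EV c Λ (M+1) f))) := by
  have conv : ∀ H : (ℤ → ℕ) → ℤ → ℤ → ℝ,
      ∑ ξ ∈ Finset.piAntidiag Λ M, Wt c Λ ξ * ∑ x ∈ Λ, ∑ y ∈ Λ, H ξ x y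
      = ∑ p ∈ Finset.piAntidiag Λ M ×ˢ (Λ ×ˢ Λ), Wt c Λ p.1 * H p.1 p.2.1 p.2.2 := by
    intro H
    rw [Finset.sum_product]
    refine Finset.sum_congr rfl fun ξ _ => ?_
    rw [Finset.sum_product, Finset.mul_sum]
    exact Finset.sum_congr rfl fun x _ => by rw [Finset.mul_sum]
  have hps := pair_sum (M := M) hc0 hc hle L hL f hf
  have h2 : ∑ ξ ∈ Finset.piAntidiag Λ M, Wt c Λ ξ * ∑ x ∈ Λ, ∑ y ∈ Λ,
      (Real.sqrt (f (up ξ x)) + Real.sqrt (f (up ξ y)))^2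
      ≤ 4 * (L * (a₁ * (M+1:ℕ) * EV c Λ (M+1) f)) := by
    calc _ ≤ ∑ ξ ∈ Finset.piAntidiag Λ M, Wt c Λ ξ * ∑ x ∈ Λ, ∑ y ∈ Λ,
          (2 * f (up ξ x) + 2 * f (up ξ y)) := by
          refine Finset.sum_le_sum fun ξ _ => mul_le_mul_of_nonneg_left ?_ (Wt_pos hc Λ ξ).le
          refine Finset.sum_le_sum fun x _ => Finset.sum_le_sum fun y _ => ?_
          have e1 := Real.sq_sqrt (hf (up ξ x))
          have e2 := Real.sq_sqrt (hf (up ξ y))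
          nlinarith [sq_nonneg (Real.sqrt (f (up ξ x)) - Real.sqrt (f (up ξ y)))]
      _ = 4 * ∑ ξ ∈ Finset.piAntidiag Λ M, Wt c Λ ξ * ∑ x ∈ Λ, ∑ _y ∈ Λ, f (up ξ x) := by
          rw [Finset.mul_sum]
          refine Finset.sum_congr rfl fun ξ _ => ?_
          simp only [Finset.sum_add_distrib, ← Finset.mul_sum]
          rw [Finset.sum_comm (f := fun x y => f (up ξ y))]
          ring
      _ ≤ _ := by linarith
  rw [conv, conv] at *
  refine (Finset.sum_sq_le_sum_mul_sum_of_sq_le_mul _ (f := fun p => Wt c Λ p.1 *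
    (Real.sqrt (f (up p.1 p.2.1)) - Real.sqrt (f (up p.1 p.2.2)))^2)
    (g := fun p => Wt c Λ p.1 *
    (Real.sqrt (f (up p.1 p.2.1)) + Real.sqrt (f (up p.1 p.2.2)))^2) ?_ ?_ ?_).trans ?_
  · exact fun p _ => mul_nonneg (Wt_pos hc Λ _).le (sq_nonneg _)
  · exact fun p _ => mul_nonneg (Wt_pos hc Λ _).le (sq_nonneg _)
  · intro p _
    have e1 := Real.sq_sqrt (hf (up p.1 p.2.1))
    have e2 := Real.sq_sqrt (hf (up p.1 p.2.2))
    refine le_of_eq ?_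
    rw [mul_pow, sq_abs]
    nth_rw 1 [← e1]
    nth_rw 1 [← e2]
    ring
  · refine mul_le_mul_of_nonneg_left h2 (Finset.sum_nonneg fun p _ => mul_nonneg (Wt_pos hc Λ _).le (sq_nonneg _))
end


/-- Dirichlet integrand -/
noncomputable def dirI (c : ℕ → ℝ) (Λ : Finset ℤ) (g : (ℤ → ℕ) → ℝ) (η : ℤ → ℕ) : ℝ :=
  (1 / 2) * ∑ x ∈ Λ, ∑ y ∈ Λ,
    if |x - y| = 1 then c (η x) * ((g (move η x y) - g η) * (g (move η x y) - g η)) else 0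

lemma dir_eq {c : ℕ → ℝ} {Λ : Finset ℤ} {M : ℕ} (hc0 : c 0 = 0) (hc : ∀ k, 0 < c (k+1))
    (g : (ℤ → ℕ) → ℝ) :
    ∑ ξ ∈ Finset.piAntidiag Λ M, Wt c Λ ξ * ∑ x ∈ Λ, ∑ y ∈ Λ,
      (if |x - y| = 1 then (g (up ξ y) - g (up ξ x))^2 else 0)
      = 2 * EV c Λ (M+1) (dirI c Λ g) := by
  have h1 := shift_sum (Λ := Λ) (M := M) hc0 hc
    (fun x η => ∑ y ∈ Λ, if |x - y| = 1 then (g (move η x y) - g η)^2 else 0)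
  rw [← EV_smul]
  refine Eq.trans ?_ (h1.trans ?_)
  · refine Finset.sum_congr rfl fun ξ _ => ?_
    congr 1
    refine Finset.sum_congr rfl fun x _ => Finset.sum_congr rfl fun y _ => ?_
    split_ifs with h
    · have : x ≠ y := by rintro rfl; simp at h
      rw [move_up _ this]
    · rfl
  · refine EV_congr c Λ _ _ _ fun η _ => ?_
    unfold dirI
    rw [← mul_assoc]; norm_num
    refine Finset.sum_congr rfl fun x _ => ?_
    rw [Finset.mul_sum]
    refine Finset.sum_congr rfl fun y _ => ?_
    split_ifs <;> ring

lemma P_le {c : ℕ → ℝ} {M : ℕ} (hc0 : c 0 = 0) (hc : ∀ k, 0 < c (k+1)) (b : ℤ) (L : ℕ)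
    (g : (ℤ → ℕ) → ℝ) :
    ∑ ξ ∈ Finset.piAntidiag (Finset.Ico b (b+L)) M, Wt c (Finset.Ico b (b+L)) ξ *
      ∑ x ∈ Finset.Ico b (b+L), ∑ y ∈ Finset.Ico b (b+L), (g (up ξ x) - g (up ξ y))^2
      ≤ 2 * L^3 * EV c (Finset.Ico b (b+L)) (M+1) (dirI c (Finset.Ico b (b+L)) g) := by
  have h1 := dir_eq (Λ := Finset.Ico b (b+L)) (M := M) hc0 hc g
  have hcard : (Finset.Ico b (b+(L:ℤ))).card = L := by simp
  calc _ ≤ ∑ ξ ∈ Finset.piAntidiag (Finset.Ico b (b+L)) M, (L:ℝ)^3 * (Wt c (Finset.Ico b (b+L)) ξ *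
      ∑ x ∈ Finset.Ico b (b+L), ∑ y ∈ Finset.Ico b (b+L),
      (if |x - y| = 1 then (g (up ξ y) - g (up ξ x))^2 else 0)) := by
        refine Finset.sum_le_sum fun ξ _ => ?_
        rw [mul_left_comm]
        refine mul_le_mul_of_nonneg_left ?_ (Wt_pos hc _ ξ).le
        refine (Finset.sum_le_sum fun x hx => Finset.sum_le_sum fun y hy =>
          moving (fun z => g (up ξ z)) b L hx hy).trans ?_
        simp only [Finset.sum_const, hcard, nsmul_eq_mul]
        refine le_of_eq ?_
        ring
    _ = _ := by rw [← Finset.mul_sum, h1]; ring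

lemma dir_nonneg {c : ℕ → ℝ} (hcn : ∀ k, 0 ≤ c k) (Λ : Finset ℤ) (g : (ℤ → ℕ) → ℝ) (η : ℤ → ℕ) :
    0 ≤ dirI c Λ g η := by
  unfold dirI
  refine mul_nonneg (by norm_num) (Finset.sum_nonneg fun x _ => Finset.sum_nonneg fun y _ => ?_)
  split_ifs
  · exact mul_nonneg (hcn _) (mul_self_nonneg _)
  · exact le_rfl

lemma main_est {c : ℕ → ℝ} {a₁ : ℝ} (hc0 : c 0 = 0) (hc : ∀ k, 0 < c (k+1)) (ha₁ : 0 < a₁)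
    (hle : ∀ k : ℕ, c k ≤ a₁ * k) (m S C : ℝ) (hm : 0 < m) (hS : 0 < S) (hC : 0 < C)
    (b : ℤ) (L M : ℕ) (hL : 2 ≤ L) (lam : ℝ) (a : ℕ → ℝ)
    (h : SiteSol c (M+1) (((M+1:ℕ):ℝ)/L) lam a) (hab : ∀ k ≤ M+1, m ≤ a k ∧ a k ≤ S)
    (had : ∀ k < M+1, |a (k+1) - a k| * ((M+1:ℕ):ℝ) ≤ C * L * Real.sqrt ((M+1:ℕ):ℝ))
    (f : (ℤ → ℕ) → ℝ) (hf : ∀ η, 0 ≤ f η) :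
    (EV c (Finset.Ico b (b+L)) (M+1) (fun η => f η * (∑ x ∈ Finset.Ico b (b+L), c (η x) - L * lam)))^2
      ≤ 2*(C*a₁*(1/m+S/m^2))^2 * ((M+1:ℕ):ℝ) * (EV c (Finset.Ico b (b+L)) (M+1) f)^2
        + 4*S^2*a₁/m^2 * ((M+1:ℕ):ℝ) * EV c (Finset.Ico b (b+L)) (M+1) f *
          (L^2 * EV c (Finset.Ico b (b+L)) (M+1)
            (dirI c (Finset.Ico b (b+L)) (fun η => Real.sqrt (f η)))) := by
  have hP := P_le (M := M) hc0 hc b L (fun η => Real.sqrt (f η))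
  have hcard : (Finset.Ico b (b+(L:ℤ))).card = L := by simp
  have hcn : ∀ k, 0 ≤ c k := fun k => by
    cases k with
    | zero => rw [hc0]
    | succ n => exact (hc n).le
  generalize Finset.Ico b (b+(L:ℤ)) = Λ at *
  obtain ⟨N, hN⟩ : ∃ N : ℝ, N = ((M+1:ℕ):ℝ) := ⟨_, rfl⟩
  have hN0 : 0 < N := by rw [hN]; positivity
  have hL0 : (0:ℝ) < L := by positivity
  obtain ⟨δ, hδ⟩ : ∃ δ, δ = C * L * Real.sqrt N / N := ⟨_, rfl⟩
  have hδN : δ * N = C * L * Real.sqrt N := by rw [hδ]; field_simp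
  have hδ0 : 0 ≤ δ := by rw [hδ]; positivity
  have hd : ∀ k < M+1, |a (k+1) - a k| ≤ δ := by
    intro k hk
    rw [hδ, le_div_iff₀ hN0, hN]; exact had k hk
  have hd' : ∀ k ≤ M+1, |a k - a (k-1)| ≤ δ := by
    intro k hk
    cases k with
    | zero => simpa using hδ0
    | succ n => exact hd n (by omega)
  obtain ⟨A, hA⟩ : ∃ A : (ℤ → ℕ) → ℝ, A = fun η => ∑ y ∈ Λ, a (η y) := ⟨_, rfl⟩
  have hAm : ∀ η ∈ Finset.piAntidiag Λ (M+1), m * L ≤ A η := by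
    intro η hη
    rw [hA]
    have := Finset.card_nsmul_le_sum Λ (fun y => a (η y)) m (fun y hy => (hab _ (conf_le hη hy)).1)
    rw [hcard, nsmul_eq_mul] at this
    linarith
  have hmL : 0 < m * L := by positivity
  obtain ⟨φ, hφ⟩ : ∃ φ : (ℤ → ℕ) → ℝ, φ = fun η => f η * L / A η := ⟨_, rfl⟩
  have hst : ∀ k : ℕ, c k * a (k-1) = lam * a k + k - ((M+1:ℕ):ℝ)/L := by
    intro k
    cases k with
    | zero => rw [hc0, h.zero]; simp
    | succ n => have := h.step n; rw [Nat.add_sub_cancel]; push_cast at *; linarith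
  have hTi := T_identity hc0 hc L hcard (by omega) lam a hst f φ (by
    intro η hη
    have := hAm η hη
    have h0 : A η ≠ 0 := by linarith
    have e : ∑ y ∈ Λ, a (η y) = A η := by rw [hA]
    rw [e, hφ]; field_simp)
  have hTb := T_bound (Λ := Λ) (M := M) hc a S (fun k hk => ⟨hm.le.trans (hab k hk).1, (hab k hk).2⟩) φ
  have hps := pair_sum (M := M) hc0 hc hle L hcard f hf
  have hCS := CS (M := M) hc0 hc hle L hcard f hf
  have hEf := EV_nonneg hc Λ (M+1) f hf
  have hD := EV_nonneg hc Λ (M+1) (dirI c Λ (fun η => Real.sqrt (f η))) (dir_nonneg hcn Λ _)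
  generalize EV c Λ (M+1) (dirI c Λ (fun η => Real.sqrt (f η))) = D at *
  -- error term
  have herr : |EV c Λ (M+1) (fun η => φ η * ∑ x ∈ Λ, c (η x) * (a (η x) - a (η x - 1)))|
      ≤ 1/m*(δ*(a₁*N)) * EV c Λ (M+1) f := by
    refine (EV_abs hc Λ _ _).trans ?_
    rw [← EV_smul]
    refine EV_mono hc Λ _ _ _ fun η hη => ?_
    have h1 := hAm η hη
    have h2 : |φ η| ≤ 1/m * f η := by
      rw [hφ]
      show |f η * L / A η| ≤ _
      rw [abs_of_nonneg (div_nonneg (mul_nonneg (hf η) hL0.le) (by linarith))]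
      rw [div_le_iff₀ (by linarith)]
      have h3 : 1/m * f η * (m * L) ≤ 1/m * f η * A η :=
        mul_le_mul_of_nonneg_left h1 (mul_nonneg (by positivity) (hf η))
      have e : 1/m * f η * (m * L) = f η * L := by field_simp
      linarith
    have h3 : |∑ x ∈ Λ, c (η x) * (a (η x) - a (η x - 1))| ≤ δ * (a₁*N) := by
      calc _ ≤ ∑ x ∈ Λ, δ * c (η x) := by
            refine (Finset.abs_sum_le_sum_abs _ _).trans (Finset.sum_le_sum fun x hx => ?_)
            rw [abs_mul, abs_of_nonneg (hcn _), mul_comm]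
            exact mul_le_mul_of_nonneg_right (hd' _ (conf_le hη hx)) (hcn _)
        _ ≤ _ := by
            rw [← Finset.mul_sum, hN]
            exact mul_le_mul_of_nonneg_left (G_le hle hη) hδ0
    rw [abs_mul]
    have := mul_le_mul h2 h3 (abs_nonneg _) (mul_nonneg (by positivity) (hf η))
    linarith
  -- the gradient term
  have hgr : ∑ ξ ∈ Finset.piAntidiag Λ M, Wt c Λ ξ * ∑ x ∈ Λ, ∑ y ∈ Λ, |φ (up ξ x) - φ (up ξ y)|
      ≤ 1/m * (∑ ξ ∈ Finset.piAntidiag Λ M, Wt c Λ ξ *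
          ∑ x ∈ Λ, ∑ y ∈ Λ, |f (up ξ x) - f (up ξ y)|)
        + (2*δ)/(m^2*L) * (∑ ξ ∈ Finset.piAntidiag Λ M, Wt c Λ ξ * ∑ x ∈ Λ, ∑ _y ∈ Λ, f (up ξ x)) := by
    rw [Finset.mul_sum, Finset.mul_sum, ← Finset.sum_add_distrib]
    refine Finset.sum_le_sum fun ξ hξ => ?_
    have e : 1/m * (Wt c Λ ξ * ∑ x ∈ Λ, ∑ y ∈ Λ, |f (up ξ x) - f (up ξ y)|)
        + (2*δ)/(m^2*L) * (Wt c Λ ξ * ∑ x ∈ Λ, ∑ _y ∈ Λ, f (up ξ x))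
        = Wt c Λ ξ * ∑ x ∈ Λ, ∑ y ∈ Λ,
          (1/m * |f (up ξ x) - f (up ξ y)| + (2*δ)/(m^2*L) * f (up ξ y)) := by
      simp only [Finset.sum_add_distrib, ← Finset.mul_sum]
      rw [Finset.sum_comm (f := fun x y => f (up ξ y))]
      ring
    rw [e]
    refine mul_le_mul_of_nonneg_left ?_ (Wt_pos hc Λ ξ).le
    refine Finset.sum_le_sum fun x hx => Finset.sum_le_sum fun y hy => ?_
    have hAd : |A (up ξ x) - A (up ξ y)| ≤ 2*δ := by
      rw [hA]
      show |∑ z ∈ Λ, a (up ξ x z) - ∑ z ∈ Λ, a (up ξ y z)| ≤ _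
      rw [sum_up Λ hx, sum_up Λ hy]
      have h1 := abs_le.1 (hd (ξ x) (Nat.lt_succ_of_le (conf_le hξ hx)))
      have h2 := abs_le.1 (hd (ξ y) (Nat.lt_succ_of_le (conf_le hξ hy)))
      exact abs_le.2 ⟨by linarith, by linarith⟩
    have := phi_diff m (2*δ) L (A (up ξ x)) (A (up ξ y)) (f (up ξ x)) (f (up ξ y)) hm hL0
      (hAm _ (up_mem hξ hx)) (hAm _ (up_mem hξ hy)) hAd (hf _)
    rw [hφ]
    show |f (up ξ x) * L / A (up ξ x) - f (up ξ y) * L / A (up ξ y)| ≤ _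
    refine this.trans (le_of_eq ?_)
    ring
  rw [hTi] at hTb
  rw [← hN] at hps hCS ⊢
  generalize (∑ ξ ∈ Finset.piAntidiag Λ M, Wt c Λ ξ * ∑ x ∈ Λ, ∑ y ∈ Λ, |φ (up ξ x) - φ (up ξ y)|) = Gr at *
  have hR0 : 0 ≤ ∑ ξ ∈ Finset.piAntidiag Λ M, Wt c Λ ξ *
          ∑ x ∈ Λ, ∑ y ∈ Λ, |f (up ξ x) - f (up ξ y)| :=
    Finset.sum_nonneg fun ξ _ => mul_nonneg (Wt_pos hc Λ ξ).le
      (Finset.sum_nonneg fun _ _ => Finset.sum_nonneg fun _ _ => abs_nonneg _)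
  generalize (∑ ξ ∈ Finset.piAntidiag Λ M, Wt c Λ ξ *
          ∑ x ∈ Λ, ∑ y ∈ Λ, |f (up ξ x) - f (up ξ y)|) = R at *
  generalize (∑ ξ ∈ Finset.piAntidiag Λ M, Wt c Λ ξ * ∑ x ∈ Λ, ∑ _y ∈ Λ, f (up ξ x)) = Q at *
  generalize (∑ ξ ∈ Finset.piAntidiag Λ M, Wt c Λ ξ * ∑ x ∈ Λ, ∑ y ∈ Λ,
          (Real.sqrt (f (up ξ x)) - Real.sqrt (f (up ξ y)))^2) = P at *
  generalize EV c Λ (M+1) (fun η => φ η * ∑ x ∈ Λ, c (η x) * (a (η x) - a (η x - 1))) = Er at *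
  generalize EV c Λ (M+1) (fun η => f η * (∑ x ∈ Λ, c (η x) - L * lam)) = X at *
  generalize EV c Λ (M+1) f = E at *
  have hs0 := Real.sqrt_nonneg N
  have hs2 : Real.sqrt N ^ 2 = N := Real.sq_sqrt hN0.le
  obtain ⟨α, hα⟩ : ∃ α, α = C*a₁*(1/m+S/m^2) := ⟨_, rfl⟩
  have hX : |L * X| ≤ L*(α*Real.sqrt N*E) + S/(2*m)*R := by
    have h1 : |L*X| ≤ |L*X - Er| + |Er| := by
      have := abs_add_le (L*X-Er) Er
      rwa [sub_add_cancel] at this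
    have h2 := mul_le_mul_of_nonneg_left hgr (by positivity : 0 ≤ S/2)
    have h3 := mul_le_mul_of_nonneg_left hps (by positivity : 0 ≤ S/2*((2*δ)/(m^2*L)))
    have e1 : S/2*((2*δ)/(m^2*L)) * (L*(a₁*N*E)) = S/m^2 * a₁ * (δ*N) * E := by field_simp
    have e2 : 1/m*(δ*(a₁*N))*E = 1/m*a₁*(δ*N)*E := by ring
    rw [e2, hδN] at herr
    rw [e1, hδN] at h3
    have e3 : L*(α*Real.sqrt N*E) = 1/m*a₁*(C*L*Real.sqrt N)*E + S/m^2*a₁*(C*L*Real.sqrt N)*E := by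
      rw [hα]; ring
    have e4 : S/(2*m)*R = S/2*(1/m*R) := by field_simp
    rw [e3, e4]
    linarith
  have hR2 : R^2 ≤ 8*a₁*L^4*N*D*E := by
    have := mul_le_mul_of_nonneg_right hP (by positivity : 0 ≤ 4*(L*(a₁*N*E)))
    refine hCS.trans (this.trans (le_of_eq ?_)); ring
  have h5 : (L*X)^2 ≤ 2*(L*(α*Real.sqrt N*E))^2 + 2*(S/(2*m)*R)^2 := by
    have h6 : (L*X)^2 ≤ (L*(α*Real.sqrt N*E) + S/(2*m)*R)^2 := by
      rw [← sq_abs]; exact pow_le_pow_left₀ (abs_nonneg _) hX 2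
    nlinarith [sq_nonneg (L*(α*Real.sqrt N*E) - S/(2*m)*R)]
  have h7 : 2*(S/(2*m)*R)^2 ≤ 2*(S/(2*m))^2*(8*a₁*L^4*N*D*E) := by
    rw [mul_pow, ← mul_assoc]; exact mul_le_mul_of_nonneg_left hR2 (by positivity)
  rw [← hα]
  refine le_of_mul_le_mul_left (a := (L:ℝ)^2) ?_ (by positivity)
  have e1 : 2*(L*(α*Real.sqrt N*E))^2 = L^2*(2*α^2*N*E^2) := by rw [← hs2]; rw [hs2]; rw [mul_pow, mul_pow, mul_pow, hs2]; ring
  have e2 : 2*(S/(2*m))^2*(8*a₁*L^4*N*D*E) = L^2*(4*S^2*a₁/m^2*N*E*(L^2*D)) := by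
    field_simp; ring
  rw [e1] at h5
  rw [e2] at h7
  have e3 : (L:ℝ)^2*X^2 = (L*X)^2 := by ring
  rw [e3]
  linarith


lemma final_small {c : ℕ → ℝ} (hc : ∀ k, 0 < c (k+1)) (hcn : ∀ k, 0 ≤ c k) {a₁ : ℝ} (ha₁ : 0 < a₁)
    (hle : ∀ k : ℕ, c k ≤ a₁ * k) (Λ : Finset ℤ) (N : ℕ) (f : (ℤ → ℕ) → ℝ) (hf : ∀ η, 0 ≤ f η)
    (hZ : 0 < EV c Λ N (fun _ => 1)) :
    (wCov (nuW c Λ N) f (fun η => ∑ x ∈ Λ, c (η x)))^2 ≤ a₁^2*N^2*(wE (nuW c Λ N) f)^2 := by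
  unfold wCov
  have hG0 : ∀ η : ℤ → ℕ, 0 ≤ ∑ x ∈ Λ, c (η x) := fun η => Finset.sum_nonneg fun _ _ => hcn _
  have h1 : 0 ≤ wE (nuW c Λ N) (fun η => f η * ∑ x ∈ Λ, c (η x)) := by
    rw [wE_eq]; exact div_nonneg (EV_nonneg hc _ _ _ fun η => mul_nonneg (hf η) (hG0 η)) hZ.le
  have h2 : wE (nuW c Λ N) (fun η => f η * ∑ x ∈ Λ, c (η x)) ≤ a₁*N*wE (nuW c Λ N) f := by
    rw [wE_eq, wE_eq, ← mul_div_assoc, ← EV_smul]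
    refine div_le_div_of_nonneg_right (EV_mono hc _ _ _ _ fun η hη => ?_) hZ.le
    rw [mul_comm]; exact mul_le_mul_of_nonneg_right (G_le hle hη) (hf η)
  have h3 : 0 ≤ wE (nuW c Λ N) (fun η => ∑ x ∈ Λ, c (η x)) := by
    rw [wE_eq]; exact div_nonneg (EV_nonneg hc _ _ _ hG0) hZ.le
  have h4 : wE (nuW c Λ N) (fun η => ∑ x ∈ Λ, c (η x)) ≤ a₁*N := by
    rw [wE_eq, div_le_iff₀ hZ, ← EV_smul]
    refine EV_mono hc _ _ _ _ fun η hη => ?_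
    rw [mul_one]; exact G_le hle hη
  have h5 : 0 ≤ wE (nuW c Λ N) f := by
    rw [wE_eq]; exact div_nonneg (EV_nonneg hc _ _ _ hf) hZ.le
  generalize wE (nuW c Λ N) f = v at *
  generalize wE (nuW c Λ N) (fun η => ∑ x ∈ Λ, c (η x)) = u at *
  generalize wE (nuW c Λ N) (fun η => f η * ∑ x ∈ Λ, c (η x)) = t at *
  have h6 := mul_le_mul_of_nonneg_left h4 h5
  have h7 := mul_nonneg h5 h3
  have h8 : |t - v*u| ≤ a₁*N*v := abs_le.2 ⟨by linarith, by linarith⟩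
  have h9 := pow_le_pow_left₀ (abs_nonneg _) h8 2
  rw [sq_abs] at h9
  refine h9.trans (le_of_eq ?_); ring

lemma final_large {c : ℕ → ℝ} (hc : ∀ k, 0 < c (k+1)) (hcn : ∀ k, 0 ≤ c k)
    (Λ : Finset ℤ) (N : ℕ) (f : (ℤ → ℕ) → ℝ) (hf : ∀ η, 0 ≤ f η)
    (hZ : 0 < EV c Λ N (fun _ => 1)) (K1 K2 L q : ℝ)
    (hm : ∀ f : (ℤ → ℕ) → ℝ, (∀ η, 0 ≤ f η) →
      (EV c Λ N (fun η => f η * (∑ x ∈ Λ, c (η x) - q)))^2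
      ≤ K1 * N * (EV c Λ N f)^2 + K2 * N * EV c Λ N f *
          (L^2 * EV c Λ N (dirI c Λ (fun η => Real.sqrt (f η))))) :
    (wCov (nuW c Λ N) f (fun η => ∑ x ∈ Λ, c (η x)))^2 ≤
      4*K1*N*(wE (nuW c Λ N) f)^2 + 2*K2*N*wE (nuW c Λ N) f *
        (L^2 * wDir c Λ (nuW c Λ N) (fun η => Real.sqrt (f η)) (fun η => Real.sqrt (f η))) := by
  have hD : wDir c Λ (nuW c Λ N) (fun η => Real.sqrt (f η)) (fun η => Real.sqrt (f η))
      = EV c Λ N (dirI c Λ (fun η => Real.sqrt (f η))) / EV c Λ N (fun _ => 1) :=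
    wE_eq c Λ N (dirI c Λ (fun η => Real.sqrt (f η)))
  have h1 := hm f hf
  have h2 := hm (fun _ => 1) (fun _ => zero_le_one)
  have h3 : EV c Λ N (dirI c Λ (fun _ => Real.sqrt 1)) = 0 := by
    refine Finset.sum_eq_zero fun η _ => ?_
    simp [dirI]
  rw [h3] at h2
  have e1 : EV c Λ N (fun η => f η * (∑ x ∈ Λ, c (η x) - q))
      = EV c Λ N (fun η => f η * ∑ x ∈ Λ, c (η x)) - q * EV c Λ N f := by
    rw [← EV_smul, ← EV_sub]; exact EV_congr _ _ _ _ _ fun η _ => by ring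
  have e2 : EV c Λ N (fun η => 1 * (∑ x ∈ Λ, c (η x) - q))
      = EV c Λ N (fun η => ∑ x ∈ Λ, c (η x)) - q * EV c Λ N (fun _ => 1) := by
    rw [← EV_smul, ← EV_sub]; exact EV_congr _ _ _ _ _ fun η _ => by ring
  rw [e1] at h1
  rw [e2] at h2
  rw [hD]
  unfold wCov
  rw [wE_eq, wE_eq, wE_eq]
  generalize EV c Λ N (dirI c Λ (fun η => Real.sqrt (f η))) = D at *
  generalize EV c Λ N (fun _ => 1) = Z at *
  generalize EV c Λ N (fun η => f η * ∑ x ∈ Λ, c (η x)) = T at *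
  generalize EV c Λ N (fun η => ∑ x ∈ Λ, c (η x)) = G at *
  generalize EV c Λ N f = E at *
  obtain ⟨X, hX⟩ : ∃ X, X = (T - q*E)/Z := ⟨_, rfl⟩
  obtain ⟨Y, hY⟩ : ∃ Y, Y = (G - q*Z)/Z := ⟨_, rfl⟩
  have e3 : T/Z - E/Z*(G/Z) = X - E/Z*Y := by rw [hX, hY]; field_simp; ring
  have h4 : X^2 ≤ K1*N*(E/Z)^2 + K2*N*(E/Z)*(L^2*(D/Z)) := by
    have := div_le_div_of_nonneg_right h1 (sq_nonneg Z)
    rw [hX, div_pow]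
    refine this.trans (le_of_eq ?_); field_simp
  have h5 : Y^2 ≤ K1*N := by
    rw [hY, div_pow, div_le_iff₀ (by positivity)]
    linarith
  rw [e3]
  have h6 := mul_le_mul_of_nonneg_left h5 (sq_nonneg (E/Z))
  nlinarith [sq_nonneg (X + E/Z*Y)]

/-- Corollary 3.11: the full two-blocks estimate for the covariance with `Σ_x c(η_x)`. -/
theorem statement13
    (c : ℕ → ℝ) (a₁ a₂ : ℝ) (k₀ : ℕ)
    (hc0 : c 0 = 0) (hcpos : ∀ n : ℕ, 0 < n → 0 < c n)
    (hLG : ∀ k : ℕ, |c (k + 1) - c k| ≤ a₁)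
    (hk₀ : 0 < k₀) (ha₂ : 0 < a₂)
    (hM : ∀ j k : ℕ, j + k₀ ≤ k → a₂ ≤ c k - c j)
    (ε : ℝ) (hε : 0 < ε) :
    ∃ Cε : ℝ, 0 < Cε ∧ ∀ (a : ℤ) (L N : ℕ), 2 ≤ L → 1 ≤ N →
      ∀ f : (ℤ → ℕ) → ℝ, (∀ η, 0 ≤ f η) →
        (wCov (nuW c (Finset.Ico a (a + (L : ℤ))) N) f
            (fun η => ∑ x ∈ Finset.Ico a (a + (L : ℤ)), c (η x))) ^ 2
          ≤ (N : ℝ) * wE (nuW c (Finset.Ico a (a + (L : ℤ))) N) f *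
              (Cε * wE (nuW c (Finset.Ico a (a + (L : ℤ))) N) f
                + Cε * (L : ℝ) ^ 2 *
                    wDir c (Finset.Ico a (a + (L : ℤ))) (nuW c (Finset.Ico a (a + (L : ℤ))) N)
                      (fun η => Real.sqrt (f η)) (fun η => Real.sqrt (f η))
                + ε * wEnt (nuW c (Finset.Ico a (a + (L : ℤ))) N) f) := by
  obtain ⟨θ, B, κ, H⟩ := exists_CH c a₁ a₂ k₀ hc0 hcpos hLG hk₀ ha₂ hM
  obtain ⟨m, S, C, K, hm, hS, hC, hK1, hone⟩ := one_site H
  have ha₁ := H.a1_pos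
  have hc := H.cpos
  have hcn := H.cnonneg
  obtain ⟨K1, hK1'⟩ : ∃ K1, K1 = 2*(C*a₁*(1/m+S/m^2))^2 := ⟨_, rfl⟩
  obtain ⟨K2, hK2'⟩ : ∃ K2, K2 = 4*S^2*a₁/m^2 := ⟨_, rfl⟩
  have hK10 : 0 < K1 := by rw [hK1']; positivity
  have hK20 : 0 < K2 := by rw [hK2']; positivity
  refine ⟨4*K1 + 2*K2 + a₁^2*K, by positivity, ?_⟩
  intro b L N hL hN f hf
  rcases (EV_nonneg hc (Finset.Ico b (b+(L:ℤ))) N (fun _ => 1) (fun _ => zero_le_one)).eq_or_lt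
    with hZ | hZ
  · have h0 : ∀ F, wE (nuW c (Finset.Ico b (b+(L:ℤ))) N) F = 0 := by
      intro F; rw [wE_eq, ← hZ, div_zero]
    simp [wCov, h0]
  have hent := ent_nonneg hc (Finset.Ico b (b+(L:ℤ))) N f hf hZ
  have hv : 0 ≤ wE (nuW c (Finset.Ico b (b+(L:ℤ))) N) f := by
    rw [wE_eq]; exact div_nonneg (EV_nonneg hc _ _ _ hf) hZ.le
  have hD : 0 ≤ wDir c (Finset.Ico b (b+(L:ℤ))) (nuW c (Finset.Ico b (b+(L:ℤ))) N)
      (fun η => Real.sqrt (f η)) (fun η => Real.sqrt (f η)) := by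
    have : wDir c (Finset.Ico b (b+(L:ℤ))) (nuW c (Finset.Ico b (b+(L:ℤ))) N)
        (fun η => Real.sqrt (f η)) (fun η => Real.sqrt (f η)) = _ :=
      wE_eq c (Finset.Ico b (b+(L:ℤ))) N (dirI c (Finset.Ico b (b+(L:ℤ))) (fun η => Real.sqrt (f η)))
    rw [this]; exact div_nonneg (EV_nonneg hc _ _ _ (dir_nonneg hcn _ _)) hZ.le
  have hN0 : (0:ℝ) < N := by exact_mod_cast hN
  have hkey : (wCov (nuW c (Finset.Ico b (b+(L:ℤ))) N) f
        (fun η => ∑ x ∈ Finset.Ico b (b + (L : ℤ)), c (η x)))^2 ≤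
      (4*K1 + a₁^2*K)*N*(wE (nuW c (Finset.Ico b (b+(L:ℤ))) N) f)^2
        + 2*K2*N*wE (nuW c (Finset.Ico b (b+(L:ℤ))) N) f *
        (L^2 * wDir c (Finset.Ico b (b+(L:ℤ))) (nuW c (Finset.Ico b (b+(L:ℤ))) N)
          (fun η => Real.sqrt (f η)) (fun η => Real.sqrt (f η))) := by
    rcases le_total K N with hKN | hKN
    · obtain ⟨lam, a, h, hab, had⟩ := hone L N hL hKN
      obtain ⟨M, rfl⟩ : ∃ M, N = M+1 := ⟨N-1, by omega⟩
      have := final_large hc hcn (Finset.Ico b (b+(L:ℤ))) (M+1) f hf hZ K1 K2 L (L*lam) (by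
        intro f hf
        have := main_est hc0 hc ha₁ H.cle m S C hm hS hC b L M hL lam a h hab had f hf
        rw [← hK1', ← hK2'] at this
        exact this)
      have h2 : 0 ≤ a₁^2*K*((M+1:ℕ):ℝ)*(wE (nuW c (Finset.Ico b (b+(L:ℤ))) (M+1)) f)^2 := by positivity
      linarith
    · have h1 := final_small hc hcn ha₁ H.cle (Finset.Ico b (b+(L:ℤ))) N f hf hZ
      have h2 : (N:ℝ) ≤ K := by exact_mod_cast hKN
      have h3 : a₁^2*(N:ℝ)^2*(wE (nuW c (Finset.Ico b (b+(L:ℤ))) N) f)^2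
          ≤ a₁^2*K*N*(wE (nuW c (Finset.Ico b (b+(L:ℤ))) N) f)^2 := by
        refine mul_le_mul_of_nonneg_right ?_ (sq_nonneg _)
        rw [sq (N:ℝ), ← mul_assoc]
        exact mul_le_mul_of_nonneg_right (mul_le_mul_of_nonneg_left h2 (by positivity)) hN0.le
      have h4 : 0 ≤ 4*K1*N*(wE (nuW c (Finset.Ico b (b+(L:ℤ))) N) f)^2 := by positivity
      have h5 : 0 ≤ 2*K2*N*wE (nuW c (Finset.Ico b (b+(L:ℤ))) N) f *
        (L^2 * wDir c (Finset.Ico b (b+(L:ℤ))) (nuW c (Finset.Ico b (b+(L:ℤ))) N)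
          (fun η => Real.sqrt (f η)) (fun η => Real.sqrt (f η))) := by positivity
      linarith
  refine hkey.trans ?_
  generalize wE (nuW c (Finset.Ico b (b+(L:ℤ))) N) f = v at *
  generalize wEnt (nuW c (Finset.Ico b (b+(L:ℤ))) N) f = e at *
  generalize wDir c (Finset.Ico b (b+(L:ℤ))) (nuW c (Finset.Ico b (b+(L:ℤ))) N)
          (fun η => Real.sqrt (f η)) (fun η => Real.sqrt (f η)) = D at *
  have g1 : 0 ≤ N*v*(2*K2*v) := by positivity
  have g2 : 0 ≤ N*v*((4*K1+a₁^2*K)*L^2*D) := by positivity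
  have g3 : 0 ≤ N*v*(ε*e) := by positivity
  linarith
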